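/- arXiv:2509.22619 — 3 statements merged into one kernel-verified Lean document; each statement's English description precedes it below -/
import Mathlib

section
/- For every integer k ≥ 2, the sequence n ↦ M_k(n)^{1/n} converges as n → ∞ to a limit μ_k, and for all integers n ≥ 3 this limit satisfies M_k(n)^{1/n} ≤ μ_k ≤ (n · M_k(n))^{1/n}. -/
/-- `numOcc v w` is the number of occurrences of `v` as a subsequence of `w`, i.e. the
number of strictly increasing maps `f : Fin |v| → Fin |w|` with `v⟨i⟩ = w⟨f i⟩`. -/
noncomputable def numOcc {α : Type*} (v w : List α) : ℕ :=
  Nat.card {f : Fin v.length → Fin w.length //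
    StrictMono f ∧ ∀ i : Fin v.length, v.get i = w.get (f i)}

/-- `maxOcc w = M(w)`, the maximum over all words `v` of `numOcc v w`. -/
noncomputable def maxOcc {α : Type*} (w : List α) : ℕ :=
  sSup {m | ∃ v : List α, numOcc v w = m}

/-- `Mmin k n = M_k(n)`, the minimum of `M(w)` over all words `w` of length `n`
over a `k`-letter alphabet. -/
noncomputable def Mmin (k n : ℕ) : ℕ :=
  sInf {m | ∃ w : List (Fin k), w.length = n ∧ maxOcc w = m}

/-- Recursive count of occurrences. -/
def occ {α : Type*} [DecidableEq α] : List α → List α → ℕ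
  | [], _ => 1
  | _ :: _, [] => 0
  | a :: v, b :: w => occ (a :: v) w + if a = b then occ v w else 0

section basic
variable {α : Type*}

theorem numOcc_nil (w : List α) : numOcc [] w = 1 := by
  unfold numOcc
  have : Unique {f : Fin ([] : List α).length → Fin w.length //
    StrictMono f ∧ ∀ i : Fin ([] : List α).length, ([] : List α).get i = w.get (f i)} :=
    { default := ⟨fun i => Fin.elim0 i, fun i => Fin.elim0 i, fun i => Fin.elim0 i⟩
      uniq := fun f => Subtype.ext (funext fun i => Fin.elim0 i) }
  exact Nat.card_unique

theorem numOcc_cons_nil (a : α) (v : List α) : numOcc (a :: v) [] = 0 := by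
  unfold numOcc
  have : IsEmpty {f : Fin (a :: v).length → Fin ([] : List α).length //
    StrictMono f ∧ ∀ i : Fin (a :: v).length, (a :: v).get i = ([] : List α).get (f i)} :=
    ⟨fun f => Fin.elim0 (f.1 ⟨0, by simp⟩)⟩
  exact Nat.card_of_isEmpty

theorem numOcc_cons_cons [DecidableEq α] (a b : α) (v w : List α) :
    numOcc (a :: v) (b :: w) = numOcc (a :: v) w + if a = b then numOcc v w else 0 := by
  classical
  set P : (Fin (v.length + 1) → Fin (w.length + 1)) → Prop := fun f =>
    StrictMono f ∧ ∀ i : Fin (v.length + 1), (a :: v).get i = (b :: w).get (f i) with hP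
  have h0 : numOcc (a :: v) (b :: w) = Nat.card {f // P f} := rfl
  have h1 : Nat.card {f // P f} =
      Nat.card {f // P f ∧ f 0 ≠ 0} + Nat.card {f // P f ∧ f 0 = 0} := by
    simp only [Nat.card_eq_fintype_card, Fintype.card_subtype]
    have h := Finset.card_filter_add_card_filter_not (s := Finset.univ.filter P)
      (fun f => f 0 = 0)
    simp only [Finset.filter_filter] at h
    rw [← h]
    exact Nat.add_comm _ _
  have h2 : Nat.card {f // P f ∧ f 0 ≠ 0} = numOcc (a :: v) w := by
    have hne : ∀ f, P f ∧ f 0 ≠ 0 → ∀ i, f i ≠ 0 := by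
      intro f hf i hi
      have := hf.1.1.monotone (Fin.zero_le i)
      rw [hi] at this
      exact hf.2 (le_antisymm this (Fin.zero_le _))
    refine Nat.card_congr
      { toFun := fun f => ⟨fun i => (f.1 i).pred (hne f.1 f.2 i), ?_, ?_⟩
        invFun := fun g => ⟨fun i => (g.1 i).succ, ⟨?_, ?_⟩, ?_⟩
        left_inv := ?_
        right_inv := ?_ }
    · intro i j hij
      exact Fin.pred_lt_pred_iff.2 (f.2.1.1 hij)
    · intro i
      have h := f.2.1.2 i
      have h' : f.1 i = ((f.1 i).pred (hne f.1 f.2 i)).succ := (Fin.succ_pred _ _).symm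
      rw [h'] at h
      exact h
    · intro i j hij
      exact Fin.succ_lt_succ_iff.2 (g.2.1 hij)
    · intro i
      exact g.2.2 i
    · exact Fin.succ_ne_zero _
    · intro f
      apply Subtype.ext
      funext i
      exact Fin.succ_pred _ (hne f.1 f.2 i)
    · intro f
      apply Subtype.ext
      funext i
      exact Fin.pred_succ _ (h := Fin.succ_ne_zero _)
  have h3 : Nat.card {f // P f ∧ f 0 = 0} = if a = b then numOcc v w else 0 := by
    split_ifs with hab
    · have hne : ∀ f, P f ∧ f 0 = 0 → ∀ i : Fin v.length, f i.succ ≠ 0 := by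
        intro f hf i hi
        have := hf.1.1 (Fin.succ_pos i)
        rw [hi] at this
        exact absurd this (Fin.not_lt_zero _)
      refine Nat.card_congr
        { toFun := fun f => ⟨fun i => (f.1 i.succ).pred (hne f.1 f.2 i), ?_, ?_⟩
          invFun := fun g => ⟨Fin.cons 0 fun i => (g.1 i).succ, ⟨?_, ?_⟩, ?_⟩
          left_inv := ?_
          right_inv := ?_ }
      · intro i j hij
        exact Fin.pred_lt_pred_iff.2 (f.2.1.1 (Fin.succ_lt_succ_iff.2 hij))
      · intro i
        have h := f.2.1.2 i.succ
        have h' : f.1 i.succ = ((f.1 i.succ).pred (hne f.1 f.2 i)).succ :=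
          (Fin.succ_pred _ _).symm
        rw [h'] at h
        exact h
      · intro i j hij
        refine Fin.cases ?_ (fun j => ?_) j hij
        · intro h
          exact absurd h (Fin.not_lt_zero _)
        · refine Fin.cases ?_ (fun i => ?_) i
          · intro _
            simp
          · intro h
            simpa using g.2.1 (Fin.succ_lt_succ_iff.1 h)
      · intro i
        refine Fin.cases ?_ (fun i => ?_) i
        · exact hab
        · exact g.2.2 i
      · rfl
      · intro f
        apply Subtype.ext
        funext i
        refine Fin.cases ?_ (fun i => ?_) i
        · exact f.2.2.symm
        · exact Fin.succ_pred _ (hne f.1 f.2 i)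
      · intro f
        apply Subtype.ext
        funext i
        exact Fin.pred_succ _ (h := Fin.succ_ne_zero _)
    · have : IsEmpty {f // P f ∧ f 0 = 0} := ⟨fun f => hab (by
        have h := f.2.1.2 0
        rw [f.2.2] at h
        exact h)⟩
      exact Nat.card_of_isEmpty
  rw [h0, h1, h2, h3]

theorem numOcc_eq_occ [DecidableEq α] (v w : List α) : numOcc v w = occ v w := by
  induction w generalizing v with
  | nil => cases v with
    | nil => simp [numOcc_nil, occ]
    | cons a v => simp [numOcc_cons_nil, occ]
  | cons b w ih => cases v with
    | nil => simp [numOcc_nil, occ]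
    | cons a v => rw [numOcc_cons_cons, occ, ih, ih]

variable [DecidableEq α]

theorem occ_nil (w : List α) : occ [] w = 1 := by cases w <;> rfl

theorem occ_le_two_pow (v w : List α) : occ v w ≤ 2 ^ w.length := by
  induction w generalizing v with
  | nil => cases v <;> simp [occ]
  | cons b w ih => cases v with
    | nil => rw [occ_nil]; exact Nat.one_le_two_pow
    | cons a v =>
      rw [occ, List.length_cons, pow_succ]
      have h1 := ih (a :: v)
      have h2 := ih v
      split_ifs <;> omega

theorem occ_eq_zero (v w : List α) (h : w.length < v.length) : occ v w = 0 := by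
  induction w generalizing v with
  | nil => cases v with
    | nil => simp at h
    | cons a v => rfl
  | cons b w ih => cases v with
    | nil => simp at h
    | cons a v =>
      simp only [List.length_cons] at h
      rw [occ, ih (a :: v) (by simp; omega), ih v (by omega)]
      simp

theorem occ_le_one (v w : List α) (h : w.length = v.length) : occ v w ≤ 1 := by
  induction w generalizing v with
  | nil => cases v <;> simp [occ]
  | cons b w ih => cases v with
    | nil => simp at h
    | cons a v =>
      simp only [List.length_cons, Nat.add_right_cancel_iff] at h
      rw [occ, occ_eq_zero (a :: v) w (by simp; omega)]
      have := ih v h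
      split_ifs <;> omega

theorem occ_append (v w₁ w₂ : List α) : occ v (w₁ ++ w₂) =
    ∑ i ∈ Finset.range (v.length + 1), occ (v.take i) w₁ * occ (v.drop i) w₂ := by
  induction w₁ generalizing v with
  | nil =>
    rw [Finset.sum_range_succ', Finset.sum_eq_zero]
    · simp [occ_nil]
    · intro i hi
      rw [occ_eq_zero]
      · simp
      · simp at hi ⊢; omega
  | cons b w ih => cases v with
    | nil => simp [occ_nil]
    | cons a v =>
      rw [List.cons_append, occ, ih, ih, List.length_cons, Finset.sum_range_succ',
        Finset.sum_range_succ' _ (v.length + 1)]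
      simp only [List.take_succ_cons, List.drop_succ_cons, List.take_zero, List.drop_zero,
        occ_nil, occ, add_mul, Finset.sum_add_distrib]
      split_ifs <;> simp <;> omega

theorem occ_mul_le (v₁ v₂ w₁ w₂ : List α) :
    occ v₁ w₁ * occ v₂ w₂ ≤ occ (v₁ ++ v₂) (w₁ ++ w₂) := by
  rw [occ_append]
  have := Finset.single_le_sum
    (f := fun i => occ ((v₁ ++ v₂).take i) w₁ * occ ((v₁ ++ v₂).drop i) w₂)
    (s := Finset.range ((v₁ ++ v₂).length + 1)) (fun _ _ => Nat.zero_le _)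
    (a := v₁.length) (by simp)
  simpa using this

theorem occ_singleton (a : α) (w : List α) : occ [a] w = w.count a := by
  induction w with
  | nil => rfl
  | cons b w ih =>
    rw [occ, ih, List.count_cons, occ_nil]
    simp only [beq_iff_eq, @eq_comm _ a b]

theorem occ_le_maxOcc (v w : List α) : occ v w ≤ maxOcc w := by
  refine le_csSup ⟨2 ^ w.length, ?_⟩ ⟨v, numOcc_eq_occ v w⟩
  rintro _ ⟨u, rfl⟩
  rw [numOcc_eq_occ]
  exact occ_le_two_pow u w

theorem exists_maxOcc (w : List α) : ∃ v, occ v w = maxOcc w := by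
  have : maxOcc w ∈ {m | ∃ v : List α, numOcc v w = m} := by
    refine Nat.sSup_mem ⟨_, [], rfl⟩ ⟨2 ^ w.length, ?_⟩
    rintro _ ⟨u, rfl⟩
    rw [numOcc_eq_occ]
    exact occ_le_two_pow u w
  obtain ⟨v, hv⟩ := this
  exact ⟨v, by rw [← numOcc_eq_occ, hv]⟩

end basic

section mmin

theorem Mmin_le (k : ℕ) (w : List (Fin k)) : Mmin k w.length ≤ maxOcc w :=
  Nat.sInf_le ⟨w, rfl, rfl⟩

theorem exists_Mmin (k n : ℕ) (hk : 0 < k) :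
    ∃ w : List (Fin k), w.length = n ∧ maxOcc w = Mmin k n := by
  have : Mmin k n ∈ {m | ∃ w : List (Fin k), w.length = n ∧ maxOcc w = m} :=
    Nat.sInf_mem ⟨_, List.replicate n ⟨0, hk⟩, by simp, rfl⟩
  exact this

theorem one_le_Mmin (k n : ℕ) (hk : 0 < k) : 1 ≤ Mmin k n := by
  obtain ⟨w, -, hw⟩ := exists_Mmin k n hk
  rw [← hw, ← occ_nil w]
  exact occ_le_maxOcc _ _

theorem Mmin_le_two_pow (k n : ℕ) (hk : 0 < k) : Mmin k n ≤ 2 ^ n := by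
  obtain ⟨w, hl, hw⟩ := exists_Mmin k n hk
  obtain ⟨v, hv⟩ := exists_maxOcc w
  rw [← hw, ← hv, ← hl]
  exact occ_le_two_pow _ _

theorem Mmin_mul_le (k m n : ℕ) (hk : 0 < k) : Mmin k m * Mmin k n ≤ Mmin k (m + n) := by
  obtain ⟨w, hl, hw⟩ := exists_Mmin k (m + n) hk
  obtain ⟨v₁, hv₁⟩ := exists_maxOcc (w.take m)
  obtain ⟨v₂, hv₂⟩ := exists_maxOcc (w.drop m)
  have h1 := Mmin_le k (w.take m)
  have h2 := Mmin_le k (w.drop m)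
  have e1 : (w.take m).length = m := by simp; omega
  have e2 : (w.drop m).length = n := by simp; omega
  rw [e1, ← hv₁] at h1
  rw [e2, ← hv₂] at h2
  have h3 := occ_mul_le v₁ v₂ (w.take m) (w.drop m)
  rw [List.take_append_drop] at h3
  calc _ ≤ _ := Nat.mul_le_mul h1 h2
    _ ≤ _ := h3
    _ ≤ maxOcc w := occ_le_maxOcc _ _
    _ = _ := hw

theorem two_le_Mmin (k n : ℕ) (hk : 0 < k) (hn : k < n) : 2 ≤ Mmin k n := by
  obtain ⟨w, hl, hw⟩ := exists_Mmin k n hk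
  have hnd : ¬ w.Nodup := by
    intro h
    have := h.length_le_card
    simp at this
    omega
  rw [List.nodup_iff_count_le_one] at hnd
  push Not at hnd
  obtain ⟨a, ha⟩ := hnd
  rw [← hw]
  refine le_trans ?_ (occ_le_maxOcc [a] w)
  rw [occ_singleton]
  exact ha

/-- Powers of the optimal word. -/
theorem Mmin_pow_le (k n : ℕ) (hk : 0 < k) (hn : 1 ≤ n) (h2 : 2 ≤ Mmin k n) (t : ℕ) :
    Mmin k (n * t) ≤ (n * Mmin k n) ^ t := by
  obtain ⟨w, hl, hw⟩ := exists_Mmin k n hk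
  set M := Mmin k n with hM
  set g : ℕ → ℕ := fun i => if i = 0 then 1 else if i < n then M else if i = n then 1 else 0
    with hg
  have hgsum : ∀ m, ∑ i ∈ Finset.range m, g i ≤ n * M := by
    intro m
    have hle : ∑ i ∈ Finset.range m, g i ≤ ∑ i ∈ Finset.range (n + 1), g i := by
      rcases le_total m (n + 1) with h | h
      · exact Finset.sum_le_sum_of_subset (by simpa using h)
      · apply le_of_eq
        symm
        apply Finset.sum_subset (by simpa using h)
        intro i _ hi
        simp at hi
        simp only [hg]
        rw [if_neg (by omega), if_neg (by omega), if_neg (by omega)]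
    refine hle.trans ?_
    obtain ⟨p, rfl⟩ : ∃ p, n = p + 1 := ⟨n - 1, by omega⟩
    rw [Finset.sum_range_succ, Finset.sum_range_succ']
    have : ∑ i ∈ Finset.range p, g (i + 1) = p * M := by
      rw [Finset.sum_congr rfl (g := fun _ => M)]
      · simp
      · intro i hi
        simp at hi
        simp only [hg]
        rw [if_neg (by omega), if_pos (by omega)]
    rw [this]
    have e1 : g 0 = 1 := by simp [hg]
    have e2 : g (p + 1) = 1 := by simp [hg]
    rw [e1, e2, add_mul]
    omega
  have hocc : ∀ v : List (Fin k), occ v w ≤ g v.length := by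
    intro v
    simp only [hg]
    split_ifs with a b c
    · rw [List.length_eq_zero_iff] at a
      rw [a, occ_nil]
    · rw [← hw]; exact occ_le_maxOcc v w
    · exact occ_le_one v w (by omega)
    · rw [occ_eq_zero v w (by omega)]
  have key : ∀ t : ℕ, ∃ u : List (Fin k), u.length = n * t ∧ ∀ v, occ v u ≤ (n * M) ^ t := by
    intro t
    induction t with
    | zero =>
      refine ⟨[], by simp, fun v => ?_⟩
      have := occ_le_two_pow v ([] : List (Fin k))
      simpa using this
    | succ t ih =>
      obtain ⟨u, hu, huv⟩ := ih
      refine ⟨w ++ u, by simp [hl, hu, mul_add]; ring, fun v => ?_⟩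
      rw [occ_append]
      calc _ ≤ ∑ i ∈ Finset.range (v.length + 1), g i * (n * M) ^ t := by
            apply Finset.sum_le_sum
            intro i hi
            simp at hi
            refine Nat.mul_le_mul ?_ (huv _)
            have := hocc (v.take i)
            rwa [List.length_take, min_eq_left (by omega)] at this
        _ = (∑ i ∈ Finset.range (v.length + 1), g i) * (n * M) ^ t := by
            rw [Finset.sum_mul]
        _ ≤ (n * M) * (n * M) ^ t := Nat.mul_le_mul_right _ (hgsum _)
        _ = _ := by rw [pow_succ]; ring
  obtain ⟨u, hu, huv⟩ := key t
  obtain ⟨v, hv⟩ := exists_maxOcc u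
  have := Mmin_le k u
  rw [hu, ← hv] at this
  exact this.trans (huv v)

/-- Prefixes of shifts of an infinite word. -/
def wd {k : ℕ} (W : ℕ → Fin k) : ℕ → ℕ → List (Fin k)
  | _, 0 => []
  | r, N + 1 => W r :: wd W (r + 1) N

theorem wd_length {k : ℕ} (W : ℕ → Fin k) (r N : ℕ) : (wd W r N).length = N := by
  induction N generalizing r with
  | zero => rfl
  | succ N ih => simp [wd, ih]

theorem potential {k : ℕ} (W : ℕ → Fin k) (z : ℝ) (hz0 : 0 ≤ z) (hz1 : z ≤ 1)
    (S : Set (ℕ → ℝ)) (hpos : ∀ u ∈ S, ∀ r, 0 ≤ u r)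
    (u₀ : ℕ → ℝ) (hu₀ : u₀ ∈ S) (h1 : ∀ r, 1 ≤ u₀ r)
    (hstep : ∀ u ∈ S, ∀ a : Fin k, ∃ u' ∈ S, ∀ r,
      z * u' (r + 1) + (if a = W r then z * u (r + 1) else 0) ≤ u' r)
    (v : List (Fin k)) : ∃ u ∈ S, ∀ N r, (occ v (wd W r N) : ℝ) * z ^ N ≤ u r := by
  induction v with
  | nil =>
    refine ⟨u₀, hu₀, fun N r => ?_⟩
    rw [occ_nil]
    have := pow_le_one₀ hz0 hz1 (n := N)
    have := h1 r
    push_cast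
    linarith
  | cons a v ih =>
    obtain ⟨u, hu, huv⟩ := ih
    obtain ⟨u', hu', h⟩ := hstep u hu a
    refine ⟨u', hu', fun N => ?_⟩
    induction N with
    | zero =>
      intro r
      simp [wd, occ, hpos u' hu' r]
    | succ N ihN =>
      intro r
      refine le_trans ?_ (h r)
      have e1 := mul_le_mul_of_nonneg_left (ihN (r + 1)) hz0
      have e2 := mul_le_mul_of_nonneg_left (huv N (r + 1)) hz0
      rw [wd, occ, pow_succ]
      split_ifs <;> push_cast <;> nlinarith

theorem Mmin_le_of_potential {k : ℕ} (W : ℕ → Fin k) (z C : ℝ) (hz0 : 0 < z) (hz1 : z ≤ 1)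
    (S : Set (ℕ → ℝ)) (hpos : ∀ u ∈ S, ∀ r, 0 ≤ u r) (hC : ∀ u ∈ S, ∀ r, u r ≤ C)
    (u₀ : ℕ → ℝ) (hu₀ : u₀ ∈ S) (h1 : ∀ r, 1 ≤ u₀ r)
    (hstep : ∀ u ∈ S, ∀ a : Fin k, ∃ u' ∈ S, ∀ r,
      z * u' (r + 1) + (if a = W r then z * u (r + 1) else 0) ≤ u' r) (N : ℕ) :
    (Mmin k N : ℝ) ≤ C * (z⁻¹) ^ N := by
  obtain ⟨v, hv⟩ := exists_maxOcc (wd W 0 N)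
  have h2 := Mmin_le k (wd W 0 N)
  rw [wd_length, ← hv] at h2
  obtain ⟨u, hu, h⟩ := potential W z hz0.le hz1 S hpos u₀ hu₀ h1 hstep v
  have h3 := (h N 0).trans (hC u hu 0)
  have hzN : 0 < z ^ N := pow_pos hz0 N
  rw [inv_pow, ← div_eq_mul_inv, le_div_iff₀ hzN]
  refine le_trans ?_ h3
  gcongr

/-- Cyclic word `0 1 ... n-1`. -/
theorem Mmin_le_cyclic (k n : ℕ) (hn : 2 ≤ n) (hk : n ≤ k) (z : ℝ) (hz0 : 0 < z)
    (hz : z + z ^ n ≤ 1) (N : ℕ) : (Mmin k N : ℝ) ≤ 1 * (z⁻¹) ^ N := by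
  have hzn : 0 < z ^ n := pow_pos hz0 n
  have hz1 : z ≤ 1 := by linarith
  refine Mmin_le_of_potential
    (fun r => ⟨r % n, (Nat.mod_lt _ (by omega)).trans_le hk⟩) z 1 hz0 hz1
    {u | ∀ r, 0 ≤ u r ∧ u r ≤ 1} (fun u hu r => (hu r).1) (fun u hu r => (hu r).2)
    (fun _ => 1) (by simp) (by simp) ?_ N
  intro u hu a
  refine ⟨fun r => z ^ ((a.1 + (n - r % n)) % n), fun r => ⟨by positivity,
    pow_le_one₀ hz0.le hz1⟩, fun r => ?_⟩
  have hr : r % n < n := Nat.mod_lt _ (by omega)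
  have hr1 : (r + 1) % n = if r % n + 1 = n then 0 else r % n + 1 := by
    rw [Nat.add_mod, Nat.mod_eq_of_lt (show 1 < n by omega)]
    split_ifs with h
    · rw [h, Nat.mod_self]
    · exact Nat.mod_eq_of_lt (by omega)
  have hstep : (a.1 + (n - r % n)) % n = ((a.1 + (n - (r + 1) % n)) + 1) % n := by
    rw [hr1]
    split_ifs with h
    · have : n - r % n = 1 := by omega
      rw [this, show a.1 + (n - 0) + 1 = a.1 + 1 + n by omega, Nat.add_mod_right]
    · congr 1
      omega
  set d := (a.1 + (n - (r + 1) % n)) with hd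
  have hdn : d % n < n := Nat.mod_lt _ (by omega)
  split_ifs with hab
  · have ha : a.1 = r % n := by rw [hab]
    have h0 : (a.1 + (n - r % n)) % n = 0 := by
      rw [ha, show r % n + (n - r % n) = n by omega, Nat.mod_self]
    have h1 : d % n = n - 1 := by
      rw [h0, Nat.add_mod, Nat.mod_eq_of_lt (show 1 < n by omega)] at hstep
      by_contra hne
      rw [Nat.mod_eq_of_lt (by omega)] at hstep
      omega
    simp only [h0, pow_zero, ← pow_succ']
    rw [← hd, h1, show n - 1 + 1 = n by omega]
    have := mul_le_mul_of_nonneg_left (hu (r + 1)).2 hz0.le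
    linarith
  · simp only [add_zero, ← pow_succ']
    apply pow_le_pow_of_le_one hz0.le hz1
    rw [hstep, Nat.add_mod, Nat.mod_eq_of_lt (show 1 < n by omega)]
    exact Nat.mod_le _ _

/-- The periodic ternary word. -/
def tW : Fin 6 → Fin 3 := ![0, 1, 0, 2, 1, 2]

/-- Potential vectors for the ternary word. -/
def tU : Fin 6 → Fin 6 → ℕ :=
  ![![50, 50, 50, 50, 50, 50], ![60, 35, 50, 21, 30, 42], ![38, 54, 27, 38, 54, 27],
    ![21, 30, 42, 60, 35, 50], ![17, 24, 34, 48, 38, 54], ![48, 38, 54, 17, 24, 34]]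

/-- Images of the potential vectors. -/
def tX : Fin 3 → Fin 6 → Fin 6 → ℕ :=
  ![![![60, 35, 50, 21, 30, 42],
      ![38, 18, 25, 14, 19, 27],
      ![59, 30, 42, 21, 30, 42],
      ![48, 38, 54, 17, 24, 34],
      ![39, 31, 44, 14, 20, 28],
      ![38, 16, 22, 14, 19, 27]],
    ![![38, 54, 27, 38, 54, 27],
      ![37, 52, 24, 34, 48, 26],
      ![21, 30, 15, 21, 30, 15],
      ![34, 48, 26, 37, 52, 24],
      ![31, 43, 27, 38, 54, 22],
      ![38, 54, 22, 31, 43, 27]],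
    ![![21, 30, 42, 60, 35, 50],
      ![17, 24, 34, 48, 38, 54],
      ![21, 30, 42, 59, 30, 42],
      ![14, 19, 27, 38, 18, 25],
      ![14, 19, 27, 38, 16, 22],
      ![14, 20, 28, 39, 31, 44]]]

theorem tX_le : ∀ (a : Fin 3) (i : Fin 6), ∃ j : Fin 6, ∀ r : Fin 6, tX a i r ≤ tU j r := by
  decide

theorem tX_step : ∀ (i : Fin 6) (a : Fin 3) (r : Fin 6),
    7 * tX a i (r + 1) + (if a = tW r then 7 * tU i (r + 1) else 0) ≤ 10 * tX a i r := by
  decide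

theorem tU_le : ∀ i r : Fin 6, tU i r ≤ 60 := by decide

theorem Mmin_le_ternary (N : ℕ) : (Mmin 3 N : ℝ) ≤ 60 * ((7 / 10 : ℝ)⁻¹) ^ N := by
  refine Mmin_le_of_potential (fun r => tW (Fin.ofNat 6 r)) (7 / 10) 60 (by norm_num)
    (by norm_num)
    {u | (∀ r, 0 ≤ u r) ∧ ∃ i : Fin 6, ∀ r : ℕ, u r ≤ (tU i (Fin.ofNat 6 r) : ℝ)}
    (fun u hu => hu.1) ?_ (fun r => (tU 0 (Fin.ofNat 6 r) : ℝ))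
    ⟨fun r => Nat.cast_nonneg _, 0, fun r => le_rfl⟩ ?_ ?_ N
  · rintro u ⟨-, i, hi⟩ r
    refine (hi r).trans ?_
    exact_mod_cast tU_le i _
  · intro r
    have : ∀ r : Fin 6, 1 ≤ tU 0 r := by decide
    exact_mod_cast this _
  · rintro u ⟨-, i, hi⟩ a
    obtain ⟨j, hj⟩ := tX_le a i
    refine ⟨fun r => (tX a i (Fin.ofNat 6 r) : ℝ), ⟨fun r => Nat.cast_nonneg _, j,
      fun r => Nat.cast_le.2 (hj _)⟩, fun r => ?_⟩
    have h := tX_step i a (Fin.ofNat 6 r)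
    have e : Fin.ofNat 6 (r + 1) = Fin.ofNat 6 r + 1 := by
      ext
      simp [Fin.val_add]
    have hu := hi (r + 1)
    simp only [e] at hu ⊢
    have h' : (7 : ℝ) * tX a i (Fin.ofNat 6 r + 1) +
        (if a = tW (Fin.ofNat 6 r) then 7 * (tU i (Fin.ofNat 6 r + 1) : ℝ) else 0)
        ≤ 10 * tX a i (Fin.ofNat 6 r) := by
      split_ifs at h ⊢ <;> exact_mod_cast h
    split_ifs at h' ⊢ <;> linarith

end mmin

section limit

theorem exists_limit (k : ℕ) (hk : 0 < k) : ∃ μ : ℝ,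
    Filter.Tendsto (fun n : ℕ => (Mmin k n : ℝ) ^ ((n : ℝ)⁻¹)) Filter.atTop (nhds μ) ∧
    ∀ n : ℕ, 1 ≤ n → (Mmin k n : ℝ) ^ ((n : ℝ)⁻¹) ≤ μ := by
  have hpos : ∀ n, (0 : ℝ) < Mmin k n := fun n => by exact_mod_cast one_le_Mmin k n hk
  have hsub : Subadditive (fun n => - Real.log (Mmin k n)) := by
    intro m n
    have h : ((Mmin k m : ℝ) * Mmin k n) ≤ Mmin k (m + n) := by
      exact_mod_cast Mmin_mul_le k m n hk
    have := Real.log_le_log (mul_pos (hpos m) (hpos n)) h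
    rw [Real.log_mul (hpos m).ne' (hpos n).ne'] at this
    linarith
  have hbdd : BddBelow (Set.range fun n : ℕ => (- Real.log (Mmin k n)) / n) := by
    refine ⟨- Real.log 2, ?_⟩
    rintro _ ⟨n, rfl⟩
    have h : (Mmin k n : ℝ) ≤ 2 ^ n := by exact_mod_cast Mmin_le_two_pow k n hk
    have h1 := Real.log_le_log (hpos n) h
    rw [Real.log_pow] at h1
    have h2 : 0 < Real.log 2 := Real.log_pos (by norm_num)
    rcases Nat.eq_zero_or_pos n with rfl | hn
    · simp [h2.le]
    · have : (0 : ℝ) < n := by exact_mod_cast hn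
      show _ ≤ (- Real.log (Mmin k n)) / n
      rw [le_div_iff₀ this]
      linarith
  have hform : ∀ n : ℕ, (Mmin k n : ℝ) ^ ((n : ℝ)⁻¹) =
      Real.exp (- ((- Real.log (Mmin k n)) / n)) := by
    intro n
    rw [Real.rpow_def_of_pos (hpos n)]
    congr 1
    rw [div_eq_mul_inv]
    ring
  refine ⟨Real.exp (- hsub.lim), ?_, ?_⟩
  · simp only [hform]
    exact (Real.continuous_exp.tendsto _).comp (hsub.tendsto_lim hbdd).neg
  · intro n hn
    rw [hform]
    have := hsub.lim_le_div hbdd (n := n) (by omega)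
    exact Real.exp_le_exp.2 (neg_le_neg this)

theorem limit_le (k : ℕ) (μ : ℝ)
    (hμ : Filter.Tendsto (fun n : ℕ => (Mmin k n : ℝ) ^ ((n : ℝ)⁻¹)) Filter.atTop (nhds μ))
    (n : ℕ) (hn : 1 ≤ n) (C B : ℝ) (hC : 0 < C) (hB : 0 < B)
    (h : ∀ t : ℕ, (Mmin k (n * t) : ℝ) ≤ C * B ^ t) : μ ≤ B ^ ((n : ℝ)⁻¹) := by
  have hn0 : (0 : ℝ) < n := by exact_mod_cast hn
  have hsub : Filter.Tendsto (fun t : ℕ => n * t) Filter.atTop Filter.atTop :=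
    Filter.tendsto_id.const_mul_atTop' (by omega)
  have h1 := hμ.comp hsub
  have h2 : Filter.Tendsto (fun t : ℕ => ((n * t : ℕ) : ℝ)⁻¹) Filter.atTop (nhds 0) :=
    (tendsto_inv_atTop_zero.comp tendsto_natCast_atTop_atTop).comp hsub
  have h3 : Filter.Tendsto (fun t : ℕ => C ^ (((n * t : ℕ) : ℝ)⁻¹) * B ^ ((n : ℝ)⁻¹))
      Filter.atTop (nhds (C ^ (0 : ℝ) * B ^ ((n : ℝ)⁻¹))) :=
    ((Real.continuousAt_const_rpow hC.ne').tendsto.comp h2).mul_const _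
  rw [Real.rpow_zero, one_mul] at h3
  refine le_of_tendsto_of_tendsto h1 h3 ?_
  filter_upwards [Filter.eventually_ge_atTop 1] with t ht
  have ht0 : (0 : ℝ) < t := by exact_mod_cast ht
  have e : (B ^ t) ^ (((n * t : ℕ) : ℝ)⁻¹) = B ^ ((n : ℝ)⁻¹) := by
    rw [← Real.rpow_natCast, ← Real.rpow_mul hB.le]
    congr 1
    push_cast
    field_simp
  show (Mmin k (n * t) : ℝ) ^ (((n * t : ℕ) : ℝ)⁻¹) ≤ _
  rw [← e, ← Real.mul_rpow hC.le (by positivity)]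
  exact Real.rpow_le_rpow (by positivity) (h t) (by positivity)

/-- The elementary inequality `n^{-1/n} + 1/n ≤ 1` for `n ≥ 4`. -/
theorem root_ineq (n : ℕ) (hn : 4 ≤ n) :
    ((n : ℝ) ^ ((n : ℝ)⁻¹))⁻¹ + (((n : ℝ) ^ ((n : ℝ)⁻¹))⁻¹) ^ n ≤ 1 := by
  obtain ⟨m, rfl⟩ : ∃ m, n = m + 1 := ⟨n - 1, by omega⟩
  have hm : (3 : ℝ) ≤ m := by exact_mod_cast (by omega : 3 ≤ m)
  have hn0 : (0 : ℝ) < ((m + 1 : ℕ) : ℝ) := by positivity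
  have hpow : (((m + 1 : ℕ) : ℝ) ^ (((m + 1 : ℕ) : ℝ)⁻¹)) ^ (m + 1) = ((m + 1 : ℕ) : ℝ) :=
    Real.rpow_inv_natCast_pow hn0.le (by omega)
  have he : (1 + 1 / (m : ℝ)) ^ m ≤ m := by
    have h1 : 1 + 1 / (m : ℝ) ≤ Real.exp (1 / m) := by
      have := Real.add_one_le_exp (1 / (m : ℝ))
      linarith
    have h2 : (1 + 1 / (m : ℝ)) ^ m ≤ Real.exp (1 / m) ^ m :=
      pow_le_pow_left₀ (by positivity) h1 m
    rw [← Real.exp_nat_mul, mul_one_div_cancel (by positivity)] at h2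
    have := Real.exp_one_lt_d9
    linarith
  have hx : 1 + 1 / (m : ℝ) ≤ ((m + 1 : ℕ) : ℝ) ^ (((m + 1 : ℕ) : ℝ)⁻¹) := by
    refine le_of_pow_le_pow_left₀ (n := m + 1) (by omega) (by positivity) ?_
    rw [hpow, pow_succ]
    calc _ ≤ (m : ℝ) * (1 + 1 / m) := by gcongr
      _ = _ := by push_cast; field_simp
  rw [inv_pow, hpow]
  have h3 := inv_anti₀ (by positivity) hx
  have h4 : (1 + 1 / (m : ℝ))⁻¹ + (((m + 1 : ℕ) : ℝ))⁻¹ = 1 := by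
    push_cast
    field_simp
  linarith

theorem limit_le_cyclic (k : ℕ) (μ : ℝ)
    (hμ : Filter.Tendsto (fun n : ℕ => (Mmin k n : ℝ) ^ ((n : ℝ)⁻¹)) Filter.atTop (nhds μ))
    (n : ℕ) (hn : 4 ≤ n) (hk : n ≤ k) : μ ≤ (n : ℝ) ^ ((n : ℝ)⁻¹) := by
  have hn0 : (0 : ℝ) < n := by exact_mod_cast (by omega : 0 < n)
  have hB : 0 < (n : ℝ) ^ ((n : ℝ)⁻¹) := Real.rpow_pos_of_pos hn0 _
  have := limit_le k μ hμ 1 le_rfl 1 ((n : ℝ) ^ ((n : ℝ)⁻¹)) one_pos hB (fun t => by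
    have := Mmin_le_cyclic k n (by omega) hk _ (inv_pos.2 hB) (root_ineq n hn) t
    rw [inv_inv] at this
    rwa [one_mul t])
  simpa using this

theorem limit_le_three (k : ℕ) (hk : 3 ≤ k) (μ : ℝ)
    (hμ : Filter.Tendsto (fun n : ℕ => (Mmin k n : ℝ) ^ ((n : ℝ)⁻¹)) Filter.atTop (nhds μ)) :
    μ ≤ (3 : ℝ) ^ ((3 : ℝ)⁻¹) := by
  have h3 : ((3 : ℝ) ^ ((3 : ℝ)⁻¹)) ^ 3 = 3 := by
    have := Real.rpow_inv_natCast_pow (x := 3) (n := 3) (by norm_num) (by norm_num)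
    exact_mod_cast this
  have h30 : (0 : ℝ) < (3 : ℝ) ^ ((3 : ℝ)⁻¹) := by positivity
  rcases Nat.lt_or_ge 3 k with h | h
  · refine (limit_le_cyclic k μ hμ 4 le_rfl h).trans ?_
    have h4 : (((4 : ℕ) : ℝ) ^ (((4 : ℕ) : ℝ)⁻¹)) ^ 4 = 4 := by
      have := Real.rpow_inv_natCast_pow (x := ((4 : ℕ) : ℝ)) (n := 4) (by norm_num) (by norm_num)
      rw [this]; norm_num
    refine le_of_pow_le_pow_left₀ (n := 12) (by norm_num) h30.le ?_
    rw [show 12 = 4 * 3 by norm_num, pow_mul, h4, show 4 * 3 = 3 * 4 by norm_num, pow_mul, h3]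
    norm_num
  · obtain rfl : k = 3 := by omega
    have := limit_le 3 μ hμ 1 le_rfl 60 ((7 / 10 : ℝ)⁻¹) (by norm_num) (by norm_num) (fun t => by
      have := Mmin_le_ternary t
      rwa [one_mul t])
    rw [Nat.cast_one, inv_one, Real.rpow_one] at this
    refine this.trans (le_of_pow_le_pow_left₀ (n := 3) (by norm_num) h30.le ?_)
    rw [h3]
    norm_num

end limit

/-- For every `k ≥ 2`, the sequence `n ↦ M_k(n)^{1/n}` converges to a limit `μ_k`,
and for every `n ≥ 3` one has `M_k(n)^{1/n} ≤ μ_k ≤ (n·M_k(n))^{1/n}`. -/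
theorem stmt0 (k : ℕ) (hk : 2 ≤ k) :
    ∃ μ : ℝ,
      Filter.Tendsto (fun n : ℕ => (Mmin k n : ℝ) ^ ((n : ℝ)⁻¹)) Filter.atTop (nhds μ) ∧
      ∀ n : ℕ, 3 ≤ n →
        (Mmin k n : ℝ) ^ ((n : ℝ)⁻¹) ≤ μ ∧
        μ ≤ ((n : ℝ) * (Mmin k n : ℝ)) ^ ((n : ℝ)⁻¹) := by
  have hk0 : 0 < k := by omega
  obtain ⟨μ, hμ, hlow⟩ := exists_limit k hk0
  refine ⟨μ, hμ, fun n hn => ⟨hlow n (by omega), ?_⟩⟩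
  have hM := one_le_Mmin k n hk0
  have hn0 : (0 : ℝ) < n := by exact_mod_cast (by omega : 0 < n)
  have hM1 : (1 : ℝ) ≤ Mmin k n := by exact_mod_cast hM
  rcases Nat.lt_or_ge k n with h | h
  · refine limit_le k μ hμ n (by omega) 1 _ one_pos (by positivity) (fun t => ?_)
    rw [one_mul]
    exact_mod_cast Mmin_pow_le k n hk0 (by omega) (two_le_Mmin k n hk0 h) t
  · have hle : (n : ℝ) ^ ((n : ℝ)⁻¹) ≤ ((n : ℝ) * (Mmin k n : ℝ)) ^ ((n : ℝ)⁻¹) :=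
      Real.rpow_le_rpow hn0.le (by nlinarith) (by positivity)
    refine le_trans ?_ hle
    rcases Nat.lt_or_ge 3 n with h4 | h4
    · exact limit_le_cyclic k μ hμ n h4 h
    · obtain rfl : n = 3 := by omega
      exact_mod_cast limit_le_three k h μ hμ
end

section
/- There exists an absolute constant C > 0 such that for every integer k ≥ 2 and every integer n ≥ C·k·log k, one has M_k(n)^{k/n} ≥ k^{1/4} / (C·(log k)^2). -/
/-- Position lists in `[x,y)` spelling `v`. -/
def OccSet {α : Type*} (W : ℕ → α) (x y : ℕ) (v : List α) : Set (List ℕ) :=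
  {l | l.Pairwise (· < ·) ∧ (∀ p ∈ l, x ≤ p ∧ p < y) ∧ l.map W = v}

lemma occSet_sub {α : Type*} (W : ℕ → α) (x y : ℕ) (v : List α) :
    OccSet W x y v ⊆ ((Finset.range y).powerset.image (fun S => S.sort (· ≤ ·)) : Finset (List ℕ)) := by
  rintro l ⟨h1, h2, -⟩
  simp only [Finset.coe_image, Set.mem_image, Finset.mem_coe, Finset.mem_powerset]
  refine ⟨l.toFinset, ?_, ?_⟩
  · intro p hp
    simp at hp ⊢
    exact (h2 p hp).2
  · refine List.Perm.eq_of_pairwise (le := (· ≤ ·)) ?_ ?_ ?_ ?_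
    · intro a b _ _ h h'; exact le_antisymm h h'
    · exact Finset.pairwise_sort _ _
    · exact h1.imp le_of_lt
    · refine (List.perm_ext_iff_of_nodup (Finset.sort_nodup _ _) (h1.imp ne_of_lt)).2 ?_
      intro a; simp

lemma occSet_finite {α : Type*} (W : ℕ → α) (x y : ℕ) (v : List α) : (OccSet W x y v).Finite :=
  (Finset.finite_toSet _).subset (occSet_sub W x y v)

lemma occSet_ncard_le {α : Type*} (W : ℕ → α) (x y : ℕ) (v : List α) :
    (OccSet W x y v).ncard ≤ 2 ^ y := by
  refine (Set.ncard_le_ncard (occSet_sub W x y v) (Finset.finite_toSet _)).trans ?_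
  rw [Set.ncard_coe_finset]
  exact Finset.card_image_le.trans (by simp)

/-- maximal multiplicity in the prefix of length `y`. -/
noncomputable def pre {α : Type*} (W : ℕ → α) (y : ℕ) : ℕ :=
  sSup {g | ∃ v, (OccSet W 0 y v).ncard = g}

lemma pre_bdd {α : Type*} (W : ℕ → α) (y : ℕ) :
    BddAbove {g | ∃ v, (OccSet W 0 y v).ncard = g} := by
  refine ⟨2 ^ y, ?_⟩
  rintro _ ⟨v, rfl⟩
  exact occSet_ncard_le W 0 y v

lemma le_pre {α : Type*} (W : ℕ → α) (y : ℕ) (v : List α) : (OccSet W 0 y v).ncard ≤ pre W y :=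
  le_csSup (pre_bdd W y) ⟨v, rfl⟩

lemma pre_attained {α : Type*} (W : ℕ → α) (y : ℕ) : ∃ v, (OccSet W 0 y v).ncard = pre W y :=
  Nat.sSup_mem (s := {g | ∃ v, (OccSet W 0 y v).ncard = g}) ⟨_, [], rfl⟩ (pre_bdd W y)

lemma pre_mul {α : Type*} (W : ℕ → α) {x y : ℕ} (hxy : x ≤ y) (v : List α) :
    pre W x * (OccSet W x y v).ncard ≤ pre W y := by
  obtain ⟨u, hu⟩ := pre_attained W x
  rw [← hu, ← Set.ncard_prod]
  refine le_trans ?_ (le_pre W y (u ++ v))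
  refine Set.ncard_le_ncard_of_injOn (fun l => l.1 ++ l.2) ?_ ?_ (occSet_finite _ _ _ _)
  · rintro ⟨l, m⟩ ⟨⟨h1, h2, h3⟩, ⟨h4, h5, h6⟩⟩
    refine ⟨?_, ?_, ?_⟩
    · rw [List.pairwise_append]
      exact ⟨h1, h4, fun a ha b hb => lt_of_lt_of_le (h2 a ha).2 (h5 b hb).1⟩
    · intro p hp
      rcases List.mem_append.1 hp with hp | hp
      · exact ⟨Nat.zero_le _, lt_of_lt_of_le (h2 p hp).2 hxy⟩
      · exact ⟨Nat.zero_le _, (h5 p hp).2⟩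
    · simp only [List.map_append] at *
      rw [h3, h6]
  · rintro ⟨l, m⟩ ⟨⟨h1, h2, h3⟩, _⟩ ⟨l', m'⟩ ⟨⟨h1', h2', h3'⟩, _⟩ h
    have : l.length = l'.length := by
      rw [← List.length_map (f := W), ← List.length_map (f := W), h3, h3']
    have := List.append_inj h this
    exact Prod.ext this.1 this.2

lemma pre_pos {α : Type*} (W : ℕ → α) (y : ℕ) : 1 ≤ pre W y := by
  refine le_trans ?_ (le_pre W y [])
  rw [Nat.one_le_iff_ne_zero, ← Nat.pos_iff_ne_zero, Set.ncard_pos (occSet_finite _ _ _ _)]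
  exact ⟨[], by simp, by simp, by simp⟩

lemma pre_zero {α : Type*} (W : ℕ → α) : pre W 0 = 1 := by
  refine le_antisymm ?_ (pre_pos W 0)
  obtain ⟨u, hu⟩ := pre_attained W 0
  rw [← hu]
  simpa using occSet_ncard_le W 0 0 u

lemma pre_mono {α : Type*} (W : ℕ → α) : Monotone (pre W) := by
  intro x y hxy
  obtain ⟨u, hu⟩ := pre_attained W x
  rw [← hu]
  refine le_trans (Set.ncard_le_ncard ?_ (occSet_finite _ _ _ _)) (le_pre W y u)
  rintro l ⟨h1, h2, h3⟩
  exact ⟨h1, fun p hp => ⟨(h2 p hp).1, lt_of_lt_of_le (h2 p hp).2 hxy⟩, h3⟩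

/-- log of the maximal multiplicity in the prefix. -/
noncomputable def logPre {α : Type*} (W : ℕ → α) (y : ℕ) : ℝ := Real.log (pre W y)

lemma logPre_zero {α : Type*} (W : ℕ → α) : logPre W 0 = 0 := by simp [logPre, pre_zero]

lemma logPre_mono {α : Type*} (W : ℕ → α) : Monotone (logPre W) := by
  intro x y hxy
  exact Real.log_le_log (by exact_mod_cast pre_pos W x) (by exact_mod_cast pre_mono W hxy)

lemma logPre_nonneg {α : Type*} (W : ℕ → α) (y : ℕ) : 0 ≤ logPre W y := by
  rw [← logPre_zero W]; exact logPre_mono W (Nat.zero_le _)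

lemma logPre_gain {α : Type*} (W : ℕ → α) {x y : ℕ} (hxy : x ≤ y) (v : List α) {g : ℕ}
    (hg : 1 ≤ g) (h : g ≤ (OccSet W x y v).ncard) : (g : ℝ) ≤ Real.exp (logPre W y - logPre W x) := by
  have h1 : (pre W x : ℝ) * g ≤ pre W y := by
    exact_mod_cast (Nat.mul_le_mul_left _ h).trans (pre_mul W hxy v)
  have hx : (0:ℝ) < pre W x := by exact_mod_cast pre_pos W x
  have hy : (0:ℝ) < pre W y := by exact_mod_cast pre_pos W y
  rw [logPre, logPre, Real.exp_sub, Real.exp_log hx, Real.exp_log hy, le_div_iff₀ hx]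
  linarith

/-- gain from a chain -/
lemma chain_gain {α : Type*} (W : ℕ → α) {x y z t : ℕ} (f g : ℕ → ℕ) (hyz : y ≤ z)
    (hxt : x ≤ t) (hyt : y ≤ t) (hxz : x ≤ z)
    (l : List ℕ) (hl : l.Pairwise (fun a b => f a < f b ∧ g a < g b))
    (hf : ∀ p ∈ l, x ≤ f p ∧ f p < y) (hg : ∀ p ∈ l, z ≤ g p ∧ g p < t)
    (hW : ∀ p ∈ l, W (f p) = W (g p)) :
    ((l.length + 1 : ℕ) : ℝ) ≤ Real.exp (logPre W t - logPre W x) := by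
  refine logPre_gain W hxt (l.map (fun p => W (f p))) (by omega) ?_
  have : ((Finset.range (l.length + 1) : Finset ℕ) : Set ℕ).ncard = l.length + 1 := by
    rw [Set.ncard_coe_finset]; simp
  rw [← this]
  refine Set.ncard_le_ncard_of_injOn (fun c => (l.take c).map f ++ (l.drop c).map g) ?_ ?_
    (occSet_finite _ _ _ _)
  · intro c hc
    have hsf : ∀ p ∈ l.take c, p ∈ l := fun p hp => List.mem_of_mem_take hp
    have hsg : ∀ p ∈ l.drop c, p ∈ l := fun p hp => List.mem_of_mem_drop hp
    refine ⟨?_, ?_, ?_⟩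
    · rw [List.pairwise_append, List.pairwise_map, List.pairwise_map]
      refine ⟨(hl.sublist (List.take_sublist _ _)).imp (fun h => h.1),
        (hl.sublist (List.drop_sublist _ _)).imp (fun h => h.2), ?_⟩
      intro a ha b hb
      obtain ⟨a', ha', rfl⟩ := List.mem_map.1 ha
      obtain ⟨b', hb', rfl⟩ := List.mem_map.1 hb
      have := hf a' (hsf _ ha')
      have := hg b' (hsg _ hb')
      omega
    · intro p hp
      rcases List.mem_append.1 hp with hp | hp
      · obtain ⟨a', ha', rfl⟩ := List.mem_map.1 hp
        have := hf a' (hsf _ ha')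
        omega
      · obtain ⟨a', ha', rfl⟩ := List.mem_map.1 hp
        have := hg a' (hsg _ ha')
        omega
    · rw [List.map_append, List.map_map, List.map_map]
      conv_rhs => rw [← List.take_append_drop c l, List.map_append]
      congr 1
      refine List.map_congr_left (fun p hp => ?_)
      exact (hW p (hsg p hp)).symm
  · have key : ∀ c c' : ℕ, c < c' → c' ≤ l.length →
        (l.take c).map f ++ (l.drop c).map g ≠ (l.take c').map f ++ (l.drop c').map g := by
      intro c c' hcc hc' heq
      have hc : c < l.length := by omega
      have h1 : ((l.take c).map f ++ (l.drop c).map g)[c]? = some (g l[c]) := by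
        rw [List.getElem?_append_right (by simp)]
        simp [hc, le_of_lt hc]
      have h2 : ((l.take c').map f ++ (l.drop c').map g)[c]? = some (f l[c]) := by
        rw [List.getElem?_append_left (by simp; omega)]
        simp [hc, hcc]
      rw [heq, h2] at h1
      have h3 : f l[c] = g l[c] := by simpa using h1
      have := hf _ (List.getElem_mem hc)
      have := hg _ (List.getElem_mem hc)
      omega
    intro c hc c' hc' heq
    simp at hc hc'
    rcases lt_trichotomy c c' with h | h | h
    · exact absurd heq (key c c' h (by omega))
    · exact h
    · exact absurd heq.symm (key c' c h (by omega))

lemma repeat_gain {α : Type*} (W : ℕ → α) {x y p q : ℕ} (hx : x ≤ p) (hpq : p < q) (hy : q < y)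
    (hW : W p = W q) : Real.log 2 ≤ logPre W y - logPre W x := by
  have : ((2 : ℕ) : ℝ) ≤ Real.exp (logPre W y - logPre W x) := by
    refine logPre_gain W (by omega) [W p] (by omega) ?_
    have : ({[p], [q]} : Set (List ℕ)).ncard = 2 := Set.ncard_pair (by simp; omega)
    rw [← this]
    refine Set.ncard_le_ncard ?_ (occSet_finite _ _ _ _)
    rintro l (rfl | rfl)
    · exact ⟨by simp, by simp; omega, by simp⟩
    · exact ⟨by simp, by simp; omega, by simp [hW]⟩
  rw [Real.log_le_iff_le_exp (by norm_num)]
  exact_mod_cast this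

/-- comparison with `maxOcc` -/
lemma pre_le_maxOcc {α : Type*} (w : List α) (W : ℕ → α)
    (hW : ∀ (i : ℕ) (hi : i < w.length), W i = w[i]) : pre W w.length ≤ maxOcc w := by
  obtain ⟨v, hv⟩ := pre_attained W w.length
  rw [← hv]
  have hb : BddAbove {m | ∃ v : List α, numOcc v w = m} := by
    refine ⟨2 ^ w.length, ?_⟩
    rintro _ ⟨v, rfl⟩
    unfold numOcc
    have : 2 ^ w.length = Nat.card (Set (Fin w.length)) := by
      rw [Nat.card_eq_fintype_card]; simp
    rw [this]
    refine Nat.card_le_card_of_injective (fun f => Set.range f.1) ?_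
    rintro ⟨f, hf, _⟩ ⟨g, hg, _⟩ h
    have h' : Set.range f = Set.range g := h
    exact Subtype.ext ((hf.range_inj hg).1 h')
  refine le_trans ?_ (le_csSup hb ⟨v, rfl⟩)
  unfold numOcc
  rw [← Nat.card_coe_set_eq]
  have hlen : ∀ l : OccSet W 0 w.length v, l.1.length = v.length := by
    rintro ⟨l, h1, h2, rfl⟩; simp
  refine Nat.card_le_card_of_injective (fun l => ⟨fun i => ⟨l.1[i.1]'(by rw [hlen l]; exact i.2),
    (l.2.2.1 _ (List.getElem_mem _)).2⟩, ?_, ?_⟩) ?_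
  · intro i j hij
    have := List.pairwise_iff_getElem.1 l.2.1 i.1 j.1 (by rw [hlen l]; exact i.2)
      (by rw [hlen l]; exact j.2) hij
    exact this
  · intro i
    obtain ⟨l, h1, h2, rfl⟩ := l
    simp
    rw [hW]
  · intro l l' h
    apply Subtype.ext
    apply List.ext_getElem
    · rw [hlen, hlen]
    · intro i h1 h2
      have := congrFun (Subtype.ext_iff.1 h) ⟨i, by rw [← hlen l]; exact h1⟩
      simpa using this
lemma height_exists (X : Finset ℕ) (r : ℕ → ℕ → Prop) (htr : ∀ a b c, r a b → r b c → r a c)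
    (B : ℕ) (hB : ∀ l : List ℕ, (∀ p ∈ l, p ∈ X) → l.Pairwise r → l.length ≤ B) :
    ∃ H : ℕ → ℕ, (∀ x ∈ X, H x < B) ∧ ∀ x ∈ X, ∀ y ∈ X, r x y → H x < H y := by
  set S : ℕ → Set ℕ := fun x =>
    {L | ∃ l : List ℕ, l.length = L ∧ (∀ y ∈ l, y ∈ X ∧ r y x) ∧ l.Pairwise r} with hS
  have hbdd : ∀ x, BddAbove (S x) := by
    intro x
    refine ⟨B, ?_⟩
    rintro _ ⟨l, rfl, h1, h2⟩
    exact hB l (fun p hp => (h1 p hp).1) h2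
  have hmem : ∀ x, sSup (S x) ∈ S x := fun x =>
    Nat.sSup_mem ⟨0, [], by simp⟩ (hbdd x)
  refine ⟨fun x => sSup (S x), ?_, ?_⟩
  · intro x hx
    obtain ⟨l, h0, h1, h2⟩ := hmem x
    have := hB (l ++ [x]) (by
      intro p hp
      rcases List.mem_append.1 hp with hp | hp
      · exact (h1 p hp).1
      · simp at hp; rw [hp]; exact hx) (by
      rw [List.pairwise_append]
      refine ⟨h2, by simp, ?_⟩
      intro a ha b hb
      simp at hb; rw [hb]; exact (h1 a ha).2)
    simp at this
    show sSup (S x) < B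
    omega
  · intro x hx y hy hxy
    obtain ⟨l, h0, h1, h2⟩ := hmem x
    have : sSup (S x) + 1 ≤ sSup (S y) := by
      refine le_csSup (hbdd y) ⟨l ++ [x], by simp [h0], ?_, ?_⟩
      · intro p hp
        rcases List.mem_append.1 hp with hp | hp
        · exact ⟨(h1 p hp).1, htr _ _ _ (h1 p hp).2 hxy⟩
        · simp at hp; rw [hp]; exact ⟨hx, hxy⟩
      · rw [List.pairwise_append]
        refine ⟨h2, by simp, ?_⟩
        intro a ha b hb
        simp at hb; rw [hb]; exact (h1 a ha).2
    exact this

lemma triple_card (X : Finset ℕ) (f g : ℕ → ℕ) (hf : Set.InjOn f X) (hg : Set.InjOn g X)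
    (B1 B2 B3 : ℕ)
    (h1 : ∀ l : List ℕ, (∀ p ∈ l, p ∈ X) →
      l.Pairwise (fun a b => a < b ∧ f a < f b) → l.length ≤ B1)
    (h2 : ∀ l : List ℕ, (∀ p ∈ l, p ∈ X) →
      l.Pairwise (fun a b => f a < f b ∧ g a < g b) → l.length ≤ B2)
    (h3 : ∀ l : List ℕ, (∀ p ∈ l, p ∈ X) →
      l.Pairwise (fun a b => a < b ∧ g a < g b) → l.length ≤ B3) :
    X.card ≤ B1 * (B2 * B3) := by
  obtain ⟨H1, a1, b1⟩ := height_exists X _ (fun a b c h h' =>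
    ⟨h.1.trans h'.1, h.2.trans h'.2⟩) B1 h1
  obtain ⟨H2, a2, b2⟩ := height_exists X _ (fun a b c h h' =>
    ⟨h.1.trans h'.1, h.2.trans h'.2⟩) B2 h2
  obtain ⟨H3, a3, b3⟩ := height_exists X _ (fun a b c h h' =>
    ⟨h.1.trans h'.1, h.2.trans h'.2⟩) B3 h3
  have hc : (Finset.range B1 ×ˢ (Finset.range B2 ×ˢ Finset.range B3)).card = B1 * (B2 * B3) := by
    simp
  rw [← hc]
  refine Finset.card_le_card_of_injOn (fun p => (H1 p, H2 p, H3 p)) ?_ ?_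
  · intro p hp
    simp
    exact ⟨a1 p hp, a2 p hp, a3 p hp⟩
  · have key : ∀ p ∈ X, ∀ q ∈ X, p < q → (H1 p, H2 p, H3 p) ≠ (H1 q, H2 q, H3 q) := by
      intro p hp q hq hpq heq
      simp only [Prod.mk.injEq] at heq
      obtain ⟨e1, e2, e3⟩ := heq
      have hfne : f p ≠ f q := fun h => hpq.ne (hf hp hq h)
      have hgne : g p ≠ g q := fun h => hpq.ne (hg hp hq h)
      rcases lt_or_gt_of_ne hfne with h | h
      · exact (b1 p hp q hq ⟨hpq, h⟩).ne e1
      · rcases lt_or_gt_of_ne hgne with h' | h'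
        · exact (b3 p hp q hq ⟨hpq, h'⟩).ne e3
        · exact (b2 q hq p hp ⟨h, h'⟩).ne e2.symm
    intro p hp q hq heq
    rcases lt_trichotomy p q with h | h | h
    · exact absurd heq (key p hp q hq h)
    · exact h
    · exact absurd heq.symm (key q hq p hp h)

/-- next occurrence of the same letter before `N`, or something `≥ N`. -/
noncomputable def nxt {α : Type*} (W : ℕ → α) (N p : ℕ) : ℕ :=
  sInf {q | p < q ∧ (W q = W p ∨ N ≤ q)}

lemma nxt_spec {α : Type*} (W : ℕ → α) (N p : ℕ) :
    p < nxt W N p ∧ (W (nxt W N p) = W p ∨ N ≤ nxt W N p) := by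
  have : ({q | p < q ∧ (W q = W p ∨ N ≤ q)} : Set ℕ).Nonempty :=
    ⟨max (p + 1) N, by simp, by simp⟩
  exact Nat.sInf_mem this

lemma lt_nxt {α : Type*} (W : ℕ → α) (N p : ℕ) : p < nxt W N p := (nxt_spec W N p).1

lemma W_nxt {α : Type*} (W : ℕ → α) {N p : ℕ} (h : nxt W N p < N) : W (nxt W N p) = W p := by
  rcases (nxt_spec W N p).2 with h' | h'
  · exact h'
  · omega

lemma nxt_le {α : Type*} (W : ℕ → α) (N : ℕ) {p q : ℕ} (h : p < q) (hW : W q = W p) :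
    nxt W N p ≤ q := Nat.sInf_le ⟨h, Or.inl hW⟩

lemma nxt_inj {α : Type*} (W : ℕ → α) {N p q : ℕ} (hp : nxt W N p < N)
    (h : nxt W N p = nxt W N q) : p = q := by
  have hq : nxt W N q < N := h ▸ hp
  have e : W p = W q := by rw [← W_nxt W hp, ← W_nxt W hq, h]
  rcases lt_trichotomy p q with h' | h' | h'
  · have := nxt_le W N h' e.symm
    have := lt_nxt W N q
    omega
  · exact h'
  · have := nxt_le W N h' e
    have := lt_nxt W N p
    omega

lemma last_inj {α : Type*} (W : ℕ → α) {N p q : ℕ} (hp : p < N) (hq : q < N)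
    (hp' : N ≤ nxt W N p) (hq' : N ≤ nxt W N q) (e : W p = W q) : p = q := by
  rcases lt_trichotomy p q with h' | h' | h'
  · have := nxt_le W N h' e.symm
    omega
  · exact h'
  · have := nxt_le W N h' e
    omega

lemma card_last {k : ℕ} (W : ℕ → Fin k) (N : ℕ) :
    ((Finset.range N).filter (fun p => ¬ nxt W N p < N)).card ≤ k := by
  have : (Finset.univ : Finset (Fin k)).card = k := by simp
  conv_rhs => rw [← this]
  refine Finset.card_le_card_of_injOn W (by simp) ?_
  intro p hp q hq e
  simp at hp hq
  exact last_inj W hp.1 hq.1 hp.2 hq.2 e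

lemma card_last2 {k : ℕ} (W : ℕ → Fin k) (N : ℕ) :
    ((Finset.range N).filter (fun p => ¬ nxt W N (nxt W N p) < N)).card ≤ 2 * k := by
  have h1 : ((Finset.range N).filter (fun p => nxt W N p < N ∧ N ≤ nxt W N (nxt W N p))).card
      ≤ k := by
    have : (Finset.univ : Finset (Fin k)).card = k := by simp
    conv_rhs => rw [← this]
    refine Finset.card_le_card_of_injOn W (by simp) ?_
    intro p hp q hq e
    simp at hp hq
    refine nxt_inj W hp.2.1 (last_inj W hp.2.1 hq.2.1 hp.2.2 hq.2.2 ?_)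
    rw [W_nxt W hp.2.1, W_nxt W hq.2.1, e]
  have h2 := card_last W N
  have h3 : (Finset.range N).filter (fun p => ¬ nxt W N (nxt W N p) < N) ⊆
      ((Finset.range N).filter (fun p => ¬ nxt W N p < N)) ∪
      ((Finset.range N).filter (fun p => nxt W N p < N ∧ N ≤ nxt W N (nxt W N p))) := by
    intro p hp
    simp at hp ⊢
    rcases lt_or_ge (nxt W N p) N with h | h
    · right; exact ⟨hp.1, h, hp.2⟩
    · left; exact ⟨hp.1, h⟩
  have := (Finset.card_le_card h3).trans (Finset.card_union_le _ _)
  omega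

lemma sum_shift (N : ℕ) (D : Finset ℕ) (hD : D ⊆ Finset.range N) (σ : ℕ → ℕ)
    (hσ : Set.InjOn σ D) (hσN : ∀ p ∈ D, σ p < N) (Φ Ψ : ℕ → ℝ) (G : ℝ) (m : ℕ)
    (hΨ : ∀ p, 0 ≤ Ψ p) (hΦ : ∀ p < N, Φ p ≤ G) (hG : 0 ≤ G)
    (hm : (Finset.range N \ D).card ≤ m) :
    ∑ p ∈ D, (Ψ (σ p) - Φ p) ≤ ∑ p ∈ Finset.range N, (Ψ p - Φ p) + m * G := by
  rw [Finset.sum_sub_distrib, Finset.sum_sub_distrib]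
  have h1 : ∑ p ∈ D, Ψ (σ p) ≤ ∑ p ∈ Finset.range N, Ψ p := by
    rw [← Finset.sum_image (f := Ψ) hσ]
    refine Finset.sum_le_sum_of_subset_of_nonneg ?_ (fun p _ _ => hΨ p)
    intro q hq
    obtain ⟨p, hp, rfl⟩ := Finset.mem_image.1 hq
    exact Finset.mem_range.2 (hσN p hp)
  have h2 := Finset.sum_sdiff (f := Φ) hD
  have h3 : ∑ p ∈ Finset.range N \ D, Φ p ≤ m * G := by
    refine (Finset.sum_le_card_nsmul _ _ G (fun p hp => ?_)).trans ?_
    · simp at hp; exact hΦ p hp.1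
    · rw [nsmul_eq_mul]
      exact mul_le_mul_of_nonneg_right (by exact_mod_cast hm) hG
  linarith

lemma block_sum (F : ℕ → ℝ) {h : ℕ} (hh : 0 < h) (R : ℕ) :
    ∑ p ∈ Finset.range (h * R), (F (h * (p / h) + h) - F (h * (p / h))) =
      h * (F (h * R) - F 0) := by
  induction R with
  | zero => simp
  | succ R ih =>
    rw [Nat.mul_succ, Finset.sum_range_add, ih]
    have : ∀ x ∈ Finset.range h, F (h * ((h * R + x) / h) + h) - F (h * ((h * R + x) / h)) =
        F (h * R + h) - F (h * R) := by
      intro x hx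
      have e : (h * R + x) / h = R := by
        rw [Nat.mul_add_div hh, Nat.div_eq_of_lt (Finset.mem_range.1 hx)]; simp
      rw [e]
    rw [Finset.sum_congr rfl this]
    simp
    ring

lemma log_sum (S : Finset ℕ) {T : Type*} [DecidableEq T] (τ : ℕ → T) (K : Finset T)
    (hK : ∀ p ∈ S, τ p ∈ K) (c : ℝ) (hc : 0 < c) :
    S.card * Real.log c + S.card - c * K.card ≤
      ∑ p ∈ S, Real.log ((S.filter (fun q => τ q = τ p)).card) := by
  have h1 : ∀ p ∈ S, Real.log c + 1 - c * (1 / ((S.filter (fun q => τ q = τ p)).card : ℝ)) ≤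
      Real.log ((S.filter (fun q => τ q = τ p)).card) := by
    intro p hp
    have hpos : (0:ℝ) < ((S.filter (fun q => τ q = τ p)).card : ℝ) := by
      exact_mod_cast Finset.card_pos.2 ⟨p, by simp [hp]⟩
    have := Real.log_le_sub_one_of_pos (div_pos hc hpos)
    rw [Real.log_div hc.ne' hpos.ne'] at this
    have e : c * (1 / ((S.filter (fun q => τ q = τ p)).card : ℝ)) =
      c / ((S.filter (fun q => τ q = τ p)).card : ℝ) := by ring
    linarith
  have h2 : ∑ p ∈ S, (1 / ((S.filter (fun q => τ q = τ p)).card : ℝ)) ≤ K.card := by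
    rw [← Finset.sum_fiberwise_of_maps_to hK]
    have : (K.card : ℝ) = ∑ t ∈ K, (1:ℝ) := by simp
    rw [this]
    refine Finset.sum_le_sum (fun t _ => ?_)
    have : ∀ p ∈ S.filter (fun q => τ q = t), 1 / ((S.filter (fun q => τ q = τ p)).card : ℝ) =
        1 / ((S.filter (fun q => τ q = t)).card : ℝ) := by
      intro p hp
      rw [(Finset.mem_filter.1 hp).2]
    rw [Finset.sum_congr rfl this]
    simp
    exact mul_inv_le_one
  have h3 := Finset.sum_le_sum h1
  rw [Finset.sum_sub_distrib, ← Finset.mul_sum] at h3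
  simp only [Finset.sum_const, nsmul_eq_mul] at h3
  have h4 := mul_le_mul_of_nonneg_left h2 hc.le
  nlinarith

/-- the window of `p` contains a repeated letter -/
def BadPos {α : Type*} (W : ℕ → α) (h p : ℕ) : Prop :=
  ∃ a b, a < b ∧ a / h = p / h ∧ b / h = p / h ∧ W a = W b

lemma div_bounds {h : ℕ} (hh : 0 < h) (p : ℕ) : h * (p / h) ≤ p ∧ p < h * (p / h) + h :=
  ⟨Nat.mul_div_le p h, Nat.lt_mul_div_succ p hh⟩

lemma bad_gain {α : Type*} (W : ℕ → α) {h p : ℕ} (hh : 0 < h) (hb : BadPos W h p) :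
    Real.log 2 ≤ logPre W (h * (p / h) + h) - logPre W (h * (p / h)) := by
  obtain ⟨a, b, hab, ha, hb, e⟩ := hb
  have h1 := div_bounds hh a
  have h2 := div_bounds hh b
  rw [ha] at h1
  rw [hb] at h2
  exact repeat_gain W h1.1 hab h2.2 e

lemma win_lt {α : Type*} (W : ℕ → α) {N h p : ℕ} (hb : ¬ BadPos W h p)
    (hp : nxt W N p < N) : p / h < nxt W N p / h := by
  have h1 : p / h ≤ nxt W N p / h := Nat.div_le_div_right (lt_nxt W N p).le
  refine lt_of_le_of_ne h1 (fun e => hb ⟨p, nxt W N p, lt_nxt W N p, rfl, e.symm, (W_nxt W hp).symm⟩)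

/-- The product bound for one type class of positions. -/
lemma type_bound {α : Type*} (W : ℕ → α) (N h : ℕ) (hh : 0 < h) (X : Finset ℕ) (i j l : ℕ)
    (hij : i < j) (hjl : j < l)
    (hX : ∀ p ∈ X, nxt W N (nxt W N p) < N ∧ p / h = i ∧ nxt W N p / h = j ∧
      nxt W N (nxt W N p) / h = l) (hne : X.Nonempty) :
    Real.log X.card ≤ (logPre W (h * j + h) - logPre W (h * i)) +
      (logPre W (h * l + h) - logPre W (h * j)) + (logPre W (h * l + h) - logPre W (h * i)) := by
  have hm : ∀ a b : ℕ, a < b → h * a + h ≤ h * b := by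
    intro a b hab
    calc h * a + h = h * (a + 1) := by ring
      _ ≤ h * b := Nat.mul_le_mul_left _ hab
  have hn1 : ∀ p ∈ X, nxt W N p < N := fun p hp => (lt_nxt W N _).trans (hX p hp).1
  have w0 : ∀ p ∈ X, h * i ≤ p ∧ p < h * i + h := by
    intro p hp; have := div_bounds hh p; rwa [(hX p hp).2.1] at this
  have w1 : ∀ p ∈ X, h * j ≤ nxt W N p ∧ nxt W N p < h * j + h := by
    intro p hp; have := div_bounds hh (nxt W N p); rwa [(hX p hp).2.2.1] at this
  have w2 : ∀ p ∈ X, h * l ≤ nxt W N (nxt W N p) ∧ nxt W N (nxt W N p) < h * l + h := by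
    intro p hp; have := div_bounds hh (nxt W N (nxt W N p)); rwa [(hX p hp).2.2.2] at this
  have e1 : ∀ p ∈ X, W p = W (nxt W N p) := fun p hp => (W_nxt W (hn1 p hp)).symm
  have e2 : ∀ p ∈ X, W (nxt W N p) = W (nxt W N (nxt W N p)) :=
    fun p hp => (W_nxt W (hX p hp).1).symm
  have m1 := hm i j hij
  have m2 := hm j l hjl
  have hcard := triple_card X (nxt W N) (fun p => nxt W N (nxt W N p))
    (fun p hp q hq e => nxt_inj W (hn1 p hp) e)
    (fun p hp q hq e => nxt_inj W (hn1 p hp) (nxt_inj W (hX p hp).1 e))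
    ⌊Real.exp (logPre W (h * j + h) - logPre W (h * i))⌋₊
    ⌊Real.exp (logPre W (h * l + h) - logPre W (h * j))⌋₊
    ⌊Real.exp (logPre W (h * l + h) - logPre W (h * i))⌋₊
    (by
      intro L hL hP
      refine Nat.le_floor (le_trans ?_ (chain_gain W (x := h * i) (y := h * i + h) (z := h * j)
        (t := h * j + h) (fun p => p) (nxt W N) (by omega) (by omega) (by omega) (by omega) L hP
        (fun p hp => w0 p (hL p hp)) (fun p hp => w1 p (hL p hp)) (fun p hp => e1 p (hL p hp))))
      push_cast; linarith)
    (by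
      intro L hL hP
      refine Nat.le_floor (le_trans ?_ (chain_gain W (x := h * j) (y := h * j + h) (z := h * l)
        (t := h * l + h) (nxt W N) (fun p => nxt W N (nxt W N p))
        (by omega) (by omega) (by omega) (by omega) L hP
        (fun p hp => w1 p (hL p hp)) (fun p hp => w2 p (hL p hp)) (fun p hp => e2 p (hL p hp))))
      push_cast; linarith)
    (by
      intro L hL hP
      refine Nat.le_floor (le_trans ?_ (chain_gain W (x := h * i) (y := h * i + h) (z := h * l)
        (t := h * l + h) (fun p => p) (fun p => nxt W N (nxt W N p))
        (by omega) (by omega) (by omega) (by omega) L hP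
        (fun p hp => w0 p (hL p hp)) (fun p hp => w2 p (hL p hp))
        (fun p hp => (e1 p (hL p hp)).trans (e2 p (hL p hp)))))
      push_cast; linarith)
  have hpos : (0:ℝ) < X.card := by exact_mod_cast Finset.card_pos.2 hne
  rw [Real.log_le_iff_le_exp hpos, Real.exp_add, Real.exp_add, mul_assoc]
  refine le_trans (b := ((_ : ℕ) : ℝ)) (by exact_mod_cast hcard) ?_
  push_cast
  gcongr
  · exact Nat.floor_le (Real.exp_pos _).le
  · exact Nat.floor_le (Real.exp_pos _).le
  · exact Nat.floor_le (Real.exp_pos _).le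

open Classical in
theorem core {k : ℕ} (W : ℕ → Fin k) (h R Y : ℕ) (hh : 0 < h) (hY : 0 < Y) (c : ℝ) (hc : 0 < c) :
    ∃ g : ℕ, ((h * R : ℕ) : ℝ) ≤ g + 2 * k + 2 * k * ((h * R : ℕ) : ℝ) / Y +
        2 * h * logPre W (h * R) / Real.log 2 ∧ g ≤ h * R ∧
      g * Real.log c + g - c * ((R * ((Y / h + 2) * (Y / h + 2)) : ℕ) : ℝ) ≤
        (4 * k + 3 * h) * logPre W (h * R) := by
  set N := h * R with hN
  set G := logPre W N with hGdef
  set σ := nxt W N with hσ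
  set F := logPre W with hF
  have hG : 0 ≤ G := logPre_nonneg W N
  set D1 := (Finset.range N).filter (fun p => σ p < N) with hD1
  set D2 := (Finset.range N).filter (fun p => σ (σ p) < N) with hD2
  have hlt : ∀ p, p < σ p := fun p => lt_nxt W N p
  have i1 : Set.InjOn σ D1 := by
    intro p hp q hq e
    exact nxt_inj W (Finset.mem_filter.1 hp).2 e
  have i2 : Set.InjOn (fun p => σ (σ p)) D2 := by
    intro p hp q hq e
    have h1 : σ (σ p) < N := (Finset.mem_filter.1 hp).2
    exact nxt_inj W ((hlt (σ p)).trans h1) (nxt_inj W h1 e)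
  have c1 : (Finset.range N \ D1).card ≤ k := by
    refine le_trans (Finset.card_le_card ?_) (card_last W N)
    intro p hp; simp [hD1] at hp ⊢; exact ⟨hp.1, hp.2 hp.1⟩
  have c2 : (Finset.range N \ D2).card ≤ 2 * k := by
    refine le_trans (Finset.card_le_card ?_) (card_last2 W N)
    intro p hp; simp [hD2] at hp ⊢; exact ⟨hp.1, hp.2 hp.1⟩
  set Φ : ℕ → ℝ := fun p => F (h * (p / h)) with hΦ
  set Ψ : ℕ → ℝ := fun p => F (h * (p / h) + h) with hΨ
  have hbs : ∑ p ∈ Finset.range N, (Ψ p - Φ p) = h * G := by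
    have := block_sum F hh R
    rw [hF, logPre_zero, sub_zero] at this
    exact this
  have hΨ0 : ∀ p, 0 ≤ Ψ p := fun p => logPre_nonneg W _
  have hΦG : ∀ p < N, Φ p ≤ G := fun p hp =>
    logPre_mono W ((Nat.mul_div_le p h).trans hp.le)
  have hΦΨ : ∀ p q, p ≤ q → 0 ≤ Ψ q - Φ p := by
    intro p q hpq
    have h1 : h * (p / h) ≤ h * (q / h) := Nat.mul_le_mul_left _ (Nat.div_le_div_right hpq)
    exact sub_nonneg.2 (logPre_mono W (by omega))
  have s1 : ∑ p ∈ D1, (Ψ (σ p) - Φ p) ≤ h * G + k * G := by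
    have := sum_shift N D1 (Finset.filter_subset _ _) σ i1
      (fun p hp => (Finset.mem_filter.1 hp).2) Φ Ψ G k hΨ0 hΦG hG c1
    rwa [hbs] at this
  have s3 : ∑ p ∈ D2, (Ψ (σ (σ p)) - Φ p) ≤ h * G + (2 * k) * G := by
    have := sum_shift N D2 (Finset.filter_subset _ _) (fun p => σ (σ p)) i2
      (fun p hp => (Finset.mem_filter.1 hp).2) Φ Ψ G (2 * k) hΨ0 hΦG hG c2
    rw [hbs] at this
    push_cast at this
    exact this
  have d21 : D2 ⊆ D1 := by
    intro p hp
    simp only [hD1, hD2, Finset.mem_filter] at hp ⊢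
    exact ⟨hp.1, (hlt _).trans hp.2⟩
  have s1' : ∑ p ∈ D2, (Ψ (σ p) - Φ p) ≤ h * G + k * G :=
    (Finset.sum_le_sum_of_subset_of_nonneg d21 (fun p _ _ => hΦΨ _ _ (hlt p).le)).trans s1
  have s2 : ∑ p ∈ D2, (Ψ (σ (σ p)) - Φ (σ p)) ≤ h * G + k * G := by
    refine le_trans ?_ s1
    rw [← Finset.sum_image (f := fun q => Ψ (σ q) - Φ q) (i1.mono (by exact_mod_cast d21))]
    refine Finset.sum_le_sum_of_subset_of_nonneg ?_ (fun p _ _ => hΦΨ _ _ (hlt p).le)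
    intro q hq
    obtain ⟨p, hp, rfl⟩ := Finset.mem_image.1 hq
    simp only [hD1, hD2, Finset.mem_filter, Finset.mem_range] at hp ⊢
    exact ⟨(hlt _).trans hp.2, hp.2⟩
  -- long arcs
  have s4 : ∑ p ∈ D2, (((σ (σ p) : ℕ) : ℝ) - (p : ℝ)) ≤ 2 * k * N := by
    have := sum_shift N D2 (Finset.filter_subset _ _) (fun p => σ (σ p)) i2
      (fun p hp => (Finset.mem_filter.1 hp).2) (fun p => (p:ℝ)) (fun p => (p:ℝ)) N (2 * k)
      (fun p => by positivity) (fun p hp => by exact_mod_cast hp.le) (by positivity) c2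
    simpa using this
  set good := D2.filter (fun p => σ (σ p) - p ≤ Y ∧ ¬ BadPos W h p ∧ ¬ BadPos W h (σ p))
    with hgood
  set long := D2.filter (fun p => Y < σ (σ p) - p) with hlong
  set bad := (Finset.range N).filter (fun p => BadPos W h p) with hbad
  set bad2 := D2.filter (fun p => BadPos W h (σ p)) with hbad2
  have b1 : (bad.card : ℝ) ≤ h * G / Real.log 2 := by
    rw [le_div_iff₀ (Real.log_pos (by norm_num)), ← hbs, ← nsmul_eq_mul]
    refine (Finset.card_nsmul_le_sum bad _ _ (fun p hp => ?_)).trans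
      (Finset.sum_le_sum_of_subset_of_nonneg (Finset.filter_subset _ _)
        (fun p _ _ => hΦΨ p p le_rfl))
    exact bad_gain W hh (Finset.mem_filter.1 hp).2
  have b2 : bad2.card ≤ bad.card := by
    refine Finset.card_le_card_of_injOn σ ?_ ?_
    · intro p hp
      simp only [hbad, hbad2, hD2, Finset.coe_filter, Set.mem_ofPred_eq, Finset.mem_filter,
        Finset.mem_range] at hp ⊢
      exact ⟨(hlt _).trans hp.1.2, hp.2⟩
    · refine i1.mono ?_
      have : bad2 ⊆ D1 := (Finset.filter_subset _ _).trans d21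
      exact_mod_cast this
  have b3 : (long.card : ℝ) ≤ 2 * k * N / Y := by
    rw [le_div_iff₀ (by exact_mod_cast hY), ← nsmul_eq_mul]
    refine le_trans ?_ s4
    refine (Finset.card_nsmul_le_sum long (fun p => ((σ (σ p) : ℕ) : ℝ) - (p : ℝ)) _
      (fun p hp => ?_)).trans
      (Finset.sum_le_sum_of_subset_of_nonneg (Finset.filter_subset _ _) (fun p _ _ => ?_))
    · have h1 := (Finset.mem_filter.1 hp).2
      have h2 : Y + p ≤ σ (σ p) := by omega
      have : (Y : ℝ) + p ≤ (σ (σ p) : ℕ) := by exact_mod_cast h2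
      show (Y : ℝ) ≤ _
      linarith
    · have h2 : p ≤ σ (σ p) := ((hlt p).trans (hlt _)).le
      have : (p : ℝ) ≤ (σ (σ p) : ℕ) := by exact_mod_cast h2
      linarith
  have hcov : Finset.range N ⊆ good ∪ ((Finset.range N \ D2) ∪ (long ∪ (bad ∪ bad2))) := by
    intro p hp
    simp only [Finset.mem_union, hgood, hlong, hbad, hbad2, Finset.mem_filter, Finset.mem_sdiff]
    by_cases q1 : p ∈ D2
    · by_cases q2 : σ (σ p) - p ≤ Y
      · by_cases q3 : BadPos W h p
        · tauto
        · tauto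
      · have := not_le.1 q2
        tauto
    · tauto
  have hcount : N ≤ good.card + (2 * k + (long.card + (bad.card + bad.card))) := by
    have t := Finset.card_le_card hcov
    rw [Finset.card_range] at t
    have t1 := Finset.card_union_le good ((Finset.range N \ D2) ∪ (long ∪ (bad ∪ bad2)))
    have t2 := Finset.card_union_le (Finset.range N \ D2) (long ∪ (bad ∪ bad2))
    have t3 := Finset.card_union_le long (bad ∪ bad2)
    have t4 := Finset.card_union_le bad bad2
    omega
  refine ⟨good.card, ?_, ?_, ?_⟩
  · have t : (N : ℝ) ≤ good.card + (2 * k + (long.card + (bad.card + bad.card))) := by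
      exact_mod_cast hcount
    have e : 2 * h * G / Real.log 2 = h * G / Real.log 2 + h * G / Real.log 2 := by ring
    rw [e]
    linarith
  · have : good ⊆ Finset.range N := (Finset.filter_subset _ _).trans (Finset.filter_subset _ _)
    simpa using Finset.card_le_card this
  · set τ : ℕ → ℕ × ℕ × ℕ := fun p => (p / h, σ p / h - p / h, σ (σ p) / h - p / h) with hτ
    set K := Finset.range R ×ˢ (Finset.range (Y / h + 2) ×ˢ Finset.range (Y / h + 2)) with hK
    have hKc : K.card = R * ((Y / h + 2) * (Y / h + 2)) := by simp [hK]
    have hKm : ∀ p ∈ good, τ p ∈ K := by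
      intro p hp
      simp only [hgood, hD2, Finset.mem_filter, Finset.mem_range] at hp
      obtain ⟨⟨u1, u2⟩, u3, -, -⟩ := hp
      have v1 : σ (σ p) / h ≤ p / h + Y / h + 1 := by
        have := div_bounds hh p
        have := div_bounds hh Y
        rw [← Nat.lt_add_one_iff, Nat.div_lt_iff_lt_mul hh]
        have e : (p / h + Y / h + 1 + 1) * h = h * (p / h) + h + (h * (Y / h) + h) := by ring
        rw [e]
        omega
      have v2 : σ p / h ≤ σ (σ p) / h := Nat.div_le_div_right (hlt _).le
      simp only [hτ, hK, Finset.mem_product, Finset.mem_range]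
      generalize σ (σ p) / h = t at v1 v2 ⊢
      generalize σ p / h = u at v2 ⊢
      generalize Y / h = s at v1 ⊢
      refine ⟨?_, by omega, by omega⟩
      rw [Nat.div_lt_iff_lt_mul hh, mul_comm]
      exact u1
    have L := log_sum good τ K hKm c hc
    rw [hKc] at L
    refine L.trans ?_
    have hterm : ∀ p ∈ good, Real.log ((good.filter (fun q => τ q = τ p)).card) ≤
        (Ψ (σ p) - Φ p) + (Ψ (σ (σ p)) - Φ (σ p)) + (Ψ (σ (σ p)) - Φ p) := by
      have hg : ∀ q ∈ good, σ (σ q) < N ∧ q / h < σ q / h ∧ σ q / h < σ (σ q) / h := by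
        intro q hq
        simp only [hgood, hD2, Finset.mem_filter, Finset.mem_range] at hq
        exact ⟨hq.1.2, win_lt W hq.2.2.1 ((hlt _).trans hq.1.2), win_lt W hq.2.2.2 hq.1.2⟩
      intro p hp
      have gp := hg p hp
      refine type_bound W N h hh _ (p / h) (σ p / h) (σ (σ p) / h) gp.2.1 gp.2.2 ?_
        ⟨p, by simp [hp]⟩
      intro q hq
      obtain ⟨hq, e⟩ := Finset.mem_filter.1 hq
      have gq := hg q hq
      simp only [hτ, Prod.mk.injEq] at e
      refine ⟨gq.1, e.1, ?_, ?_⟩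
      · show σ q / h = σ p / h
        omega
      · show σ (σ q) / h = σ (σ p) / h
        omega
    refine (Finset.sum_le_sum hterm).trans ?_
    refine (Finset.sum_le_sum_of_subset_of_nonneg (Finset.filter_subset _ D2)
      (fun p _ _ => ?_)).trans ?_
    · have a1 := hΦΨ p (σ p) (hlt p).le
      have a2 := hΦΨ (σ p) (σ (σ p)) (hlt _).le
      have a3 := hΦΨ p (σ (σ p)) ((hlt p).trans (hlt _)).le
      linarith
    · rw [Finset.sum_add_distrib, Finset.sum_add_distrib]
      linarith

set_option maxHeartbeats 1000000 in
/-- The final numerical estimate. -/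
lemma numeric (k n h R Y g ℓ G : ℝ) (hℓ : 1 ≤ ℓ) (hk : 10 ^ 8 * ℓ ^ 8 ≤ k) (hkℓ : Real.log k = ℓ)
    (hn : 100 * k * ℓ ≤ n) (hh1 : k / (2 * ℓ ^ 2) ≤ h) (hh2 : h ≤ k / ℓ ^ 2)
    (hR1 : h * R ≤ n) (hR2 : n ≤ h * R + h) (hR0 : 0 ≤ R) (hY1 : k * ℓ ≤ Y)
    (hY2 : Y ≤ k * ℓ + 1) (hG0 : 0 ≤ G) (hG : G ≤ n * ℓ / (4 * k)) (hg0 : 0 ≤ g)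
    (hgN : g ≤ h * R)
    (hlost : h * R ≤ g + 2 * k + 2 * k * (h * R) / Y + 2 * h * G / Real.log 2)
    (hmain : g * Real.log (k / (72 * ℓ ^ 8)) + g - k / (72 * ℓ ^ 8) * (R * ((Y / h + 2) * (Y / h + 2)))
      ≤ (4 * k + 3 * h) * G) :
    ℓ / 4 - 2 * Real.log ℓ - 7 / 2 ≤ k * G / n := by
  have hℓ0 : 0 < ℓ := by linarith
  have hℓ2 : 1 ≤ ℓ ^ 2 := one_le_pow₀ hℓ
  have hℓ8 : 1 ≤ ℓ ^ 8 := one_le_pow₀ hℓ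
  have hk8 : 10 ^ 8 ≤ k := by nlinarith
  have hk0 : 0 < k := by linarith
  have hh0 : 0 < h := lt_of_lt_of_le (by positivity) hh1
  have hn0 : 0 < n := lt_of_lt_of_le (by positivity) hn
  have hY0 : 0 < Y := lt_of_lt_of_le (by positivity) hY1
  -- lost positions
  have hlog2 : 1 / 2 ≤ Real.log 2 := by have := Real.log_two_gt_d9; linarith
  have l1 : 2 * k ≤ n / ℓ / 50 := by
    rw [div_div, le_div_iff₀ (by positivity)]; nlinarith
  have l2 : 2 * k * (h * R) / Y ≤ 2 * (n / ℓ) := by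
    rw [div_le_iff₀ hY0]
    calc 2 * k * (h * R) ≤ 2 * k * n := by gcongr
      _ = 2 * (n / ℓ) * (k * ℓ) := by field_simp
      _ ≤ 2 * (n / ℓ) * Y := by gcongr
  have l3 : 2 * h * G / Real.log 2 ≤ n / ℓ := by
    rw [div_le_iff₀ (by linarith)]
    calc 2 * h * G ≤ 2 * (k / ℓ ^ 2) * (n * ℓ / (4 * k)) := by gcongr
      _ = n / ℓ * (1 / 2) := by field_simp; norm_num
      _ ≤ n / ℓ * Real.log 2 := by gcongr
  have l4 : h ≤ n / ℓ / 50 := by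
    have : k / ℓ ^ 2 ≤ k := div_le_self hk0.le hℓ2
    linarith
  have hgn : n - 4 * (n / ℓ) ≤ g := by
    have : 0 ≤ n / ℓ := by positivity
    linarith
  -- number of types
  have q1 : Y / h + 2 ≤ 3 * (k * ℓ) / h := by
    rw [le_div_iff₀ hh0, add_mul, div_mul_cancel₀ _ hh0.ne']
    have hlogk : 2 ≤ ℓ := by
      rw [← hkℓ, Real.le_log_iff_exp_le hk0]
      have e1 : Real.exp 2 = Real.exp 1 * Real.exp 1 := by rw [← Real.exp_add]; norm_num
      have := Real.exp_one_lt_d9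
      have := Real.exp_pos 1
      rw [e1]; nlinarith
    have u1 : k / ℓ ^ 2 ≤ k / 4 := by
      gcongr; nlinarith
    have u2 : k * 2 ≤ k * ℓ := by gcongr
    linarith
  have q2 : k / (72 * ℓ ^ 8) * (R * ((Y / h + 2) * (Y / h + 2))) ≤ n := by
    have hR' : R ≤ n / h := by rw [le_div_iff₀ hh0]; linarith
    calc k / (72 * ℓ ^ 8) * (R * ((Y / h + 2) * (Y / h + 2)))
        ≤ k / (72 * ℓ ^ 8) * (n / h * ((3 * (k * ℓ) / h) * (3 * (k * ℓ) / h))) := by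
          have : 0 ≤ Y / h + 2 := by positivity
          gcongr
      _ = n * ((k / (2 * ℓ ^ 2)) ^ 3 / h ^ 3) := by field_simp; norm_num
      _ ≤ n * 1 := by
          gcongr
          rw [div_le_one (by positivity)]
          gcongr
      _ = n := by ring
  have hlogc : Real.log (k / (72 * ℓ ^ 8)) = ℓ - 8 * Real.log ℓ - Real.log 72 := by
    rw [Real.log_div hk0.ne' (by positivity), hkℓ, Real.log_mul (by norm_num) (by positivity),
      Real.log_pow]
    push_cast; ring
  have hlog72 : Real.log 72 ≤ 5 := by
    have : Real.log 72 ≤ Real.log (2 ^ 7) := Real.log_le_log (by norm_num) (by norm_num)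
    rw [Real.log_pow] at this
    have := Real.log_two_lt_d9
    push_cast at *
    linarith
  have hlogc0 : 0 ≤ Real.log (k / (72 * ℓ ^ 8)) := by
    refine Real.log_nonneg ?_
    rw [le_div_iff₀ (by positivity)]
    linarith
  have hlog72' : 0 ≤ Real.log 72 := Real.log_nonneg (by norm_num)
  have hlogℓ : 0 ≤ Real.log ℓ := Real.log_nonneg hℓ
  set c := Real.log (k / (72 * ℓ ^ 8)) with hcdef
  have hcℓ : c ≤ ℓ := by linarith
  have r1 : (n - 4 * (n / ℓ)) * (c + 1) ≤ g * (c + 1) := by gcongr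
  have r2 : 4 * (n / ℓ) * (c + 1) ≤ 8 * n := by
    calc 4 * (n / ℓ) * (c + 1) ≤ 4 * (n / ℓ) * (ℓ + ℓ) := by gcongr
      _ = 8 * n := by field_simp; norm_num
  have r3 : 3 * h * G ≤ n := by
    calc 3 * h * G ≤ 3 * (k / ℓ ^ 2) * (n * ℓ / (4 * k)) := by gcongr
      _ = n * (3 / 4 / ℓ) := by field_simp
      _ ≤ n * 1 := by
          gcongr
          rw [div_le_one hℓ0]; linarith
      _ = n := by ring
  have r4 : n * (c - 9) ≤ 4 * (k * G) := by linarith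
  rw [le_div_iff₀ hn0]
  have r5 : n * (ℓ - 8 * Real.log ℓ - 14) ≤ n * (c - 9) := by
    refine mul_le_mul_of_nonneg_left ?_ hn0.le
    linarith
  linarith

theorem word_bound (k n : ℕ) (hk : 2 ≤ k) (hn : 100 * (k:ℝ) * Real.log k ≤ n)
    (hbig : 100 * Real.log k ^ 2 < (k : ℝ) ^ ((1:ℝ) / 4)) (W : ℕ → Fin k) :
    Real.log k / 4 - 2 * Real.log (Real.log k) - 7 / 2 ≤ k * logPre W n / n ∧ 1 ≤ Real.log k := by
  set ℓ := Real.log k with hℓdef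
  have hk0 : (0:ℝ) < k := by positivity
  have hℓpos : 0 < ℓ := Real.log_pos (by exact_mod_cast hk)
  have hx4 : ((k : ℝ) ^ ((1:ℝ) / 4)) ^ 4 = k := by
    rw [← Real.rpow_natCast, ← Real.rpow_mul hk0.le]; norm_num
  have hk8 : 10 ^ 8 * ℓ ^ 8 ≤ (k:ℝ) := by
    rw [← hx4]
    calc 10 ^ 8 * ℓ ^ 8 = (100 * ℓ ^ 2) ^ 4 := by ring
      _ ≤ _ := by gcongr
  have hℓ : 1 ≤ ℓ := by
    have h2 : Real.log 2 ≤ ℓ := Real.log_le_log (by norm_num) (by exact_mod_cast hk)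
    have h3 : 1 / 2 ≤ ℓ := by have := Real.log_two_gt_d9; linarith
    have h4 : (1 / 2 : ℝ) ^ 8 ≤ ℓ ^ 8 := by gcongr
    have h5 : (3:ℝ) ≤ k := by nlinarith
    rw [hℓdef, Real.le_log_iff_exp_le hk0]
    have := Real.exp_one_lt_d9
    linarith
  refine ⟨?_, hℓ⟩
  have hℓ8 : 1 ≤ ℓ ^ 8 := one_le_pow₀ hℓ
  have hn0 : (0:ℝ) < n := lt_of_lt_of_le (by positivity) hn
  have hkl2 : 2 ≤ (k:ℝ) / ℓ ^ 2 := by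
    rw [le_div_iff₀ (by positivity)]
    have : ℓ ^ 2 ≤ ℓ ^ 8 := pow_le_pow_right₀ hℓ (by norm_num)
    nlinarith
  set h := ⌊(k:ℝ) / ℓ ^ 2⌋₊ with hh
  have hh2 : (h:ℝ) ≤ k / ℓ ^ 2 := Nat.floor_le (by positivity)
  have hh1 : (k:ℝ) / (2 * ℓ ^ 2) ≤ h := by
    have h1 := Nat.lt_floor_add_one ((k:ℝ) / ℓ ^ 2)
    rw [← hh] at h1
    have e : (k:ℝ) / (2 * ℓ ^ 2) = k / ℓ ^ 2 / 2 := by field_simp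
    rw [e]; linarith
  have hhpos : 0 < h := by
    have : (0:ℝ) < h := lt_of_lt_of_le (by positivity) hh1
    exact_mod_cast this
  set R := n / h with hR
  set Y := ⌈(k:ℝ) * ℓ⌉₊ with hY
  have hY1 : (k:ℝ) * ℓ ≤ Y := Nat.le_ceil _
  have hY2 : (Y:ℝ) ≤ k * ℓ + 1 := (Nat.ceil_lt_add_one (by positivity)).le
  have hYpos : 0 < Y := Nat.ceil_pos.2 (by positivity)
  have hNn : h * R ≤ n := Nat.mul_div_le n h
  have hNn2 : n ≤ h * R + h := (Nat.lt_mul_div_succ n hhpos).le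
  have hmono : logPre W (h * R) ≤ logPre W n := logPre_mono W hNn
  by_cases hcase : (n:ℝ) * ℓ / (4 * k) < logPre W (h * R)
  · rw [le_div_iff₀ hn0]
    have h1 : (n:ℝ) * ℓ / (4 * k) < logPre W n := lt_of_lt_of_le hcase hmono
    rw [div_lt_iff₀ (by positivity)] at h1
    have h2 : 0 ≤ Real.log ℓ := Real.log_nonneg hℓ
    have h3 : (ℓ / 4 - 2 * Real.log ℓ - 7 / 2) * n ≤ ℓ / 4 * n := by gcongr; linarith
    linarith
  · obtain ⟨g, g1, g2, g3⟩ := core W h R Y hhpos hYpos (k / (72 * ℓ ^ 8)) (by positivity)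
    have := numeric k n h R Y g ℓ (logPre W (h * R)) hℓ hk8 rfl hn hh1 hh2
      (by exact_mod_cast hNn) (by exact_mod_cast hNn2) (by positivity) hY1 hY2
      (logPre_nonneg _ _) (not_lt.1 hcase) (by positivity) (by exact_mod_cast g2)
      (by push_cast at g1; exact g1) ?_
    · refine this.trans ?_
      gcongr
    · refine le_trans ?_ g3
      push_cast
      have : ((Y / h : ℕ) : ℝ) ≤ (Y:ℝ) / h := Nat.cast_div_le
      gcongr

/-- There is an absolute constant `C > 0` such that for all `k ≥ 2` and all
`n ≥ C·k·log k`, one has `M_k(n)^{k/n} ≥ k^{1/4} / (C·(log k)²)`. -/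
theorem stmt1 :
    ∃ C : ℝ, 0 < C ∧ ∀ k n : ℕ, 2 ≤ k → C * k * Real.log k ≤ n →
      (k : ℝ) ^ ((1 : ℝ) / 4) / (C * Real.log k ^ 2) ≤
        (Mmin k n : ℝ) ^ ((k : ℝ) / (n : ℝ)) := by
  refine ⟨100, by norm_num, ?_⟩
  intro k n hk hn
  have hk0 : (0:ℝ) < k := by positivity
  have hℓpos : 0 < Real.log k := Real.log_pos (by exact_mod_cast hk)
  have hn0 : (0:ℝ) < n := lt_of_lt_of_le (by positivity) hn
  obtain ⟨w, hwn, hwM⟩ : Mmin k n ∈ {m | ∃ w : List (Fin k), w.length = n ∧ maxOcc w = m} :=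
    Nat.sInf_mem ⟨_, List.replicate n ⟨0, by omega⟩, by simp, rfl⟩
  set W : ℕ → Fin k := fun i => w.getD i ⟨0, by omega⟩ with hW
  have hle : pre W n ≤ Mmin k n := by
    rw [← hwM, ← hwn]
    refine pre_le_maxOcc w W ?_
    intro i hi
    simp [hW, hi]
  have hpre : (1:ℝ) ≤ pre W n := by exact_mod_cast pre_pos W n
  have hle' : (pre W n : ℝ) ≤ Mmin k n := by exact_mod_cast hle
  rcases le_or_gt ((k : ℝ) ^ ((1:ℝ) / 4)) (100 * Real.log k ^ 2) with hs | hbig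
  · refine le_trans ((div_le_one (by positivity)).2 hs) ?_
    exact Real.one_le_rpow (hpre.trans hle') (by positivity)
  · obtain ⟨hb, hℓ⟩ := word_bound k n hk hn hbig W
    refine le_trans ?_ (Real.rpow_le_rpow (by positivity) hle' (by positivity))
    rw [Real.rpow_def_of_pos (by linarith : (0:ℝ) < pre W n)]
    have e : Real.log (pre W n) * ((k:ℝ) / n) = k * logPre W n / n := by
      rw [logPre]; ring
    rw [e]
    refine le_trans ?_ (Real.exp_le_exp.2 hb)
    rw [Real.exp_sub, Real.exp_sub, Real.rpow_def_of_pos hk0]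
    have e2 : Real.exp (2 * Real.log (Real.log k)) = Real.log k ^ 2 := by
      rw [mul_comm, Real.exp_mul, Real.exp_log hℓpos]; norm_num
    rw [e2, div_div, mul_comm (100:ℝ), mul_one_div]
    have e3 : Real.exp (7 / 2) ≤ 100 := by
      have h1 : Real.exp (7 / 2) ≤ Real.exp 4 := Real.exp_le_exp.2 (by norm_num)
      have h2 : Real.exp 4 = Real.exp 1 ^ 4 := by rw [← Real.exp_nat_mul]; norm_num
      have h3 : Real.exp 1 ^ 4 ≤ 2.72 ^ 4 := by
        have := Real.exp_one_lt_d9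
        gcongr; linarith
      norm_num at h3
      linarith
    gcongr
end

section
/- There exist absolute constants c > 0 and C > 0 such that for every integer k ≥ 2, every integer n ≥ C·k·log k, and every word w of length n over the alphabet [k] = {1,…,k}, one has M(w) ≥ (c·k / (log k)^8)^{n/(4k)}. -/
namespace SubseqOcc

theorem numOcc_le {α : Type*} (v w : List α) : numOcc v w ≤ 2 ^ w.length := by
  unfold numOcc
  have h : Nat.card {f : Fin v.length → Fin w.length //
      StrictMono f ∧ ∀ i : Fin v.length, v.get i = w.get (f i)} ≤ Nat.card (Set (Fin w.length)) := by
    apply Nat.card_le_card_of_injective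
      (fun f => Set.range f.1)
    intro f g hfg
    exact Subtype.ext ((StrictMono.range_inj f.2.1 g.2.1).1 hfg)
  simpa using h

theorem bdd {α : Type*} (w : List α) : BddAbove {m | ∃ v : List α, numOcc v w = m} :=
  ⟨2 ^ w.length, by rintro _ ⟨v, rfl⟩; exact numOcc_le v w⟩

theorem numOcc_le_maxOcc {α : Type*} (v w : List α) : numOcc v w ≤ maxOcc w :=
  le_csSup (bdd w) ⟨v, rfl⟩

theorem exists_maxOcc {α : Type*} (w : List α) : ∃ v : List α, numOcc v w = maxOcc w :=
  Nat.sSup_mem (s := {m | ∃ v : List α, numOcc v w = m}) ⟨_, [], rfl⟩ (bdd w)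

theorem one_le_maxOcc {α : Type*} (w : List α) : 1 ≤ maxOcc w := by
  refine le_trans ?_ (numOcc_le_maxOcc [] w)
  unfold numOcc
  have : Nonempty {f : Fin ([] : List α).length → Fin w.length //
      StrictMono f ∧ ∀ i : Fin ([] : List α).length, ([] : List α).get i = w.get (f i)} :=
    ⟨⟨fun i => absurd i.2 (by simp), fun i => absurd i.2 (by simp),
      fun i => absurd i.2 (by simp)⟩⟩
  exact Nat.card_pos

theorem numOcc_append {α : Type*} (v₁ v₂ x y : List α) :
    numOcc v₁ x * numOcc v₂ y ≤ numOcc (v₁ ++ v₂) (x ++ y) := by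
  unfold numOcc
  rw [← Nat.card_prod]
  let F : (Fin v₁.length → Fin x.length) → (Fin v₂.length → Fin y.length) →
      Fin (v₁ ++ v₂).length → Fin (x ++ y).length := fun f g i =>
    if h : i.1 < v₁.length then
      ⟨(f ⟨i.1, h⟩).1, by have := (f ⟨i.1, h⟩).2; simp; omega⟩
    else
      have hi : i.1 - v₁.length < v₂.length := by
        have := i.2; simp only [List.length_append] at this; omega
      ⟨x.length + (g ⟨i.1 - v₁.length, hi⟩).1, by
        have := (g ⟨i.1 - v₁.length, hi⟩).2; simp⟩
  refine Nat.card_le_card_of_injective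
    (fun p => ⟨F p.1.1 p.2.1, ?_, ?_⟩) ?_
  · rcases p with ⟨⟨f, hf, hf'⟩, ⟨g, hg, hg'⟩⟩
    intro i j hij
    have hij' : i.1 < j.1 := hij
    simp only [F, Fin.lt_def]
    split_ifs with h1 h2 h2
    · exact hf (show (⟨i.1, h1⟩ : Fin v₁.length) < ⟨j.1, h2⟩ from hij')
    · have := (f ⟨i.1, h1⟩).2
      dsimp only
      omega
    · omega
    · dsimp only
      have : ∀ hi hj, g ⟨i.1 - v₁.length, hi⟩ < g ⟨j.1 - v₁.length, hj⟩ := fun hi hj =>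
        hg (show (⟨i.1 - v₁.length, hi⟩ : Fin v₂.length) < ⟨j.1 - v₁.length, hj⟩ from by
          simp only [Fin.lt_def]; omega)
      have h3 := this (by have := i.2; simp only [List.length_append] at this; omega)
        (by have := j.2; simp only [List.length_append] at this; omega)
      simp only [Fin.lt_def] at h3
      omega
  · rcases p with ⟨⟨f, hf, hf'⟩, ⟨g, hg, hg'⟩⟩
    intro i
    simp only [F]
    split_ifs with h
    · have := hf' ⟨i.1, h⟩
      simp only [List.get_eq_getElem] at this ⊢
      rw [List.getElem_append_left h, List.getElem_append_left (by exact (f ⟨i.1, h⟩).2)]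
      exact this
    · have := hg' ⟨i.1 - v₁.length, by
        have := i.2; simp only [List.length_append] at this; omega⟩
      simp only [List.get_eq_getElem] at this ⊢
      rw [List.getElem_append_right (by omega), List.getElem_append_right (by simp)]
      simpa using this
  · rintro ⟨⟨f, hf, hf'⟩, ⟨g, hg, hg'⟩⟩ ⟨⟨f2, hf2, hf2'⟩, ⟨g2, hg2, hg2'⟩⟩ h
    simp only [Subtype.mk.injEq] at h
    have e1 : f = f2 := by
      funext i
      have := congrFun h ⟨i.1, by have := i.2; simp; omega⟩
      simpa [F, Fin.ext_iff] using this
    have e2 : g = g2 := by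
      funext i
      have := congrFun h ⟨v₁.length + i.1, by simp⟩
      simpa [F, Fin.ext_iff] using this
    subst e1 e2
    rfl

theorem maxOcc_append {α : Type*} (x y : List α) :
    maxOcc x * maxOcc y ≤ maxOcc (x ++ y) := by
  obtain ⟨v₁, h₁⟩ := exists_maxOcc x
  obtain ⟨v₂, h₂⟩ := exists_maxOcc y
  rw [← h₁, ← h₂]
  exact (numOcc_append _ _ _ _).trans (numOcc_le_maxOcc _ _)

theorem card_le_maxOcc {α : Type*} {s m : ℕ} (w : List α) (v : Fin s → α)
    (Φ : Fin m → Fin s → Fin w.length) (hinj : Function.Injective Φ)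
    (hmono : ∀ a, StrictMono (Φ a)) (hv : ∀ a j, v j = w.get (Φ a j)) :
    m ≤ maxOcc w := by
  refine le_trans ?_ (numOcc_le_maxOcc (List.ofFn v) w)
  unfold numOcc
  have hl : (List.ofFn v).length = s := List.length_ofFn
  rw [← Nat.card_fin m]
  refine Nat.card_le_card_of_injective
    (fun a => ⟨fun j => Φ a (Fin.cast hl j), ?_, ?_⟩) ?_
  · intro i j hij
    exact hmono a (show Fin.cast hl i < Fin.cast hl j from hij)
  · intro i
    simp only [List.get_ofFn]
    exact hv _ _
  · intro a b h
    apply hinj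
    funext j
    have := congrFun (congrArg Subtype.val h) (Fin.cast hl.symm j)
    simpa using this

/-- A chain of `s` repeated letters gives multiplicity at least `s + 1`. -/
theorem chain_fin {α : Type*} {s : ℕ} (w : List α) (p q : Fin s → Fin w.length)
    (hp : StrictMono p) (hq : StrictMono q) (hpq : ∀ j, p j < q j)
    (hw : ∀ j, w.get (p j) = w.get (q j)) : s + 1 ≤ maxOcc w := by
  refine card_le_maxOcc w (fun j => w.get (p j))
    (fun (a : Fin (s + 1)) j => if j.1 < a.1 then p j else q j) ?_ ?_ ?_
  · have key : ∀ a b : Fin (s + 1), a < b →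
        (fun j : Fin s => if j.1 < a.1 then p j else q j) ≠
          (fun j : Fin s => if j.1 < b.1 then p j else q j) := by
      intro a b hab h
      have hab' : a.1 < b.1 := hab
      have := congrFun h ⟨a.1, by have := b.2; omega⟩
      simp only [lt_irrefl, if_false, hab', if_true] at this
      exact (hpq _).ne' this
    intro a b h
    rcases lt_trichotomy a b with h1 | h1 | h1
    · exact absurd h (key a b h1)
    · exact h1
    · exact absurd h.symm (key b a h1)
  · intro a i j hij
    have hij' : i.1 < j.1 := hij
    dsimp only
    split_ifs with h1 h2 h2
    · exact hp hij
    · exact (hp hij).trans (hpq j)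
    · omega
    · exact hq hij
  · intro a j
    split_ifs
    · rfl
    · exact hw j

/-- Chain lemma for a finset of pairs inside the segment `[A, B)` of `w`. -/
theorem chain_finset {α τ : Type*} (w : List α) (A B : ℕ) (t : Finset τ) (p q : τ → ℕ)
    (hA : ∀ x ∈ t, A ≤ p x) (hpq : ∀ x ∈ t, p x < q x) (hB : ∀ x ∈ t, q x < B)
    (hn : ∀ x ∈ t, q x < w.length) (hw : ∀ x ∈ t, w[p x]? = w[q x]?)
    (hch : ∀ x ∈ t, ∀ y ∈ t, x ≠ y → (p x < p y ∧ q x < q y) ∨ (p y < p x ∧ q y < q x)) :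
    t.card + 1 ≤ maxOcc ((w.take B).drop A) := by
  classical
  have hinj : Set.InjOn p t := by
    intro x hx y hy h
    by_contra hne
    rcases hch x hx y hy hne with h' | h' <;> omega
  have hcard : (t.image p).card = t.card := Finset.card_image_of_injOn hinj
  let e := (t.image p).orderEmbOfFin hcard
  have hex : ∀ j, ∃ x ∈ t, p x = e j := fun j => by
    have := Finset.orderEmbOfFin_mem (t.image p) hcard j
    exact Finset.mem_image.1 this
  choose x hxt hx using hex
  have hp : ∀ i j, i < j → p (x i) < p (x j) := fun i j hij => by
    rw [hx, hx]; exact e.strictMono hij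
  have hlen : ∀ i, i < B → i < w.length → A ≤ i → i - A < ((w.take B).drop A).length := by
    intro i h1 h2 h3
    simp only [List.length_drop, List.length_take]
    omega
  refine chain_fin ((w.take B).drop A)
    (fun j => ⟨p (x j) - A, hlen _ ((hpq _ (hxt j)).trans (hB _ (hxt j)))
      ((hpq _ (hxt j)).trans (hn _ (hxt j))) (hA _ (hxt j))⟩)
    (fun j => ⟨q (x j) - A, hlen _ (hB _ (hxt j)) (hn _ (hxt j))
      ((hA _ (hxt j)).trans (hpq _ (hxt j)).le)⟩) ?_ ?_ ?_ ?_
  · intro i j hij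
    have := hp i j hij
    have := hA _ (hxt i)
    simp only [Fin.lt_def]
    omega
  · intro i j hij
    have h1 := hp i j hij
    have h2 := hA _ (hxt i)
    have h3 := hpq _ (hxt i)
    have hne : x i ≠ x j := fun h => by rw [h] at h1; omega
    simp only [Fin.lt_def]
    rcases hch _ (hxt i) _ (hxt j) hne with h' | h' <;> omega
  · intro j
    have h2 := hA _ (hxt j)
    have h3 := hpq _ (hxt j)
    simp only [Fin.lt_def]
    omega
  · intro j
    have h2 := hA _ (hxt j)
    have h3 := hpq _ (hxt j)
    have h4 := hn _ (hxt j)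
    have h5 := hw _ (hxt j)
    rw [List.getElem?_eq_getElem (h3.trans h4), List.getElem?_eq_getElem h4] at h5
    simp only [Option.some.injEq] at h5
    have e1 : A + (p (x j) - A) = p (x j) := by omega
    have e2 : A + (q (x j) - A) = q (x j) := by omega
    simp only [List.get_eq_getElem, List.getElem_drop, List.getElem_take, e1, e2]
    exact h5

/-- Longest-chain labels: if all chains are shorter than `m`, there is a strictly
increasing labelling with fewer than `m` values. -/
theorem exists_label {τ : Type*} (S : Finset τ) (R : τ → τ → Prop)
    (htr : ∀ x y z, R x y → R y z → R x z) (hirr : ∀ x, ¬ R x x) (m : ℕ)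
    (hm : ∀ t ⊆ S, (∀ x ∈ t, ∀ y ∈ t, x ≠ y → R x y ∨ R y x) → t.card + 1 ≤ m) :
    ∃ lab : τ → ℕ, (∀ x ∈ S, lab x < m) ∧ ∀ x ∈ S, ∀ y ∈ S, R x y → lab x < lab y := by
  classical
  let D : τ → Finset (Finset τ) := fun x => S.powerset.filter fun t =>
    (∀ y ∈ t, R y x) ∧ ∀ y ∈ t, ∀ z ∈ t, y ≠ z → R y z ∨ R z y
  refine ⟨fun x => (D x).sup Finset.card, ?_, ?_⟩
  · intro x hx
    have h0 : 1 ≤ m := by simpa using hm ∅ (by simp) (by simp)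
    rw [Finset.sup_lt_iff (show ⊥ < m from h0)]
    intro t ht
    simp only [D, Finset.mem_filter, Finset.mem_powerset] at ht
    have := hm t ht.1 ht.2.2
    omega
  · intro x hx y hy hxy
    have hne : (D x).Nonempty := ⟨∅, by simp [D]⟩
    obtain ⟨t, ht, hte⟩ := Finset.exists_mem_eq_sup (D x) hne Finset.card
    have ht' := ht
    simp only [D, Finset.mem_filter, Finset.mem_powerset] at ht'
    have hxt : x ∉ t := fun h => hirr x (ht'.2.1 x h)
    have hmem : insert x t ∈ D y := by
      simp only [D, Finset.mem_filter, Finset.mem_powerset]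
      refine ⟨Finset.insert_subset hx ht'.1, ?_, ?_⟩
      · intro z hz
        rcases Finset.mem_insert.1 hz with rfl | hz
        · exact hxy
        · exact htr _ _ _ (ht'.2.1 z hz) hxy
      · intro a ha b hb hab
        rcases Finset.mem_insert.1 ha with rfl | ha' <;>
          rcases Finset.mem_insert.1 hb with rfl | hb'
        · exact absurd rfl hab
        · exact Or.inr (ht'.2.1 _ hb')
        · exact Or.inl (ht'.2.1 _ ha')
        · exact ht'.2.2 _ ha' _ hb' hab
    have h1 := Finset.le_sup (f := Finset.card) hmem
    rw [Finset.card_insert_of_notMem hxt] at h1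
    dsimp only
    omega

theorem pair_label {α τ : Type*} (w : List α) (A B : ℕ) (S : Finset τ) (p q : τ → ℕ)
    (hA : ∀ x ∈ S, A ≤ p x) (hpq : ∀ x ∈ S, p x < q x) (hB : ∀ x ∈ S, q x < B)
    (hn : ∀ x ∈ S, q x < w.length) (hw : ∀ x ∈ S, w[p x]? = w[q x]?) :
    ∃ lab : τ → ℕ, (∀ x ∈ S, lab x < maxOcc ((w.take B).drop A)) ∧
      ∀ x ∈ S, ∀ y ∈ S, p x < p y ∧ q x < q y → lab x < lab y := by
  refine exists_label S (fun x y => p x < p y ∧ q x < q y) (fun x y z h1 h2 => by omega)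
    (fun x h => by omega) _ ?_
  intro t ht hch
  exact chain_finset w A B t p q (fun x hx => hA x (ht hx)) (fun x hx => hpq x (ht hx))
    (fun x hx => hB x (ht hx)) (fun x hx => hn x (ht hx)) (fun x hx => hw x (ht hx)) hch

theorem triple_card {α τ : Type*} (w : List α) (A₁ A₂ B₂ B₃ : ℕ) (S : Finset τ)
    (p q r : τ → ℕ)
    (hA1 : ∀ x ∈ S, A₁ ≤ p x) (hA2 : ∀ x ∈ S, A₂ ≤ q x)
    (hpq : ∀ x ∈ S, p x < q x) (hqr : ∀ x ∈ S, q x < r x)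
    (hB2 : ∀ x ∈ S, q x < B₂) (hB3 : ∀ x ∈ S, r x < B₃)
    (hn : ∀ x ∈ S, r x < w.length) (hw : ∀ x ∈ S, w[p x]? = w[q x]?)
    (hw' : ∀ x ∈ S, w[q x]? = w[r x]?)
    (hp : Set.InjOn p S) (hq : Set.InjOn q S) (hr : Set.InjOn r S) :
    S.card ≤ maxOcc ((w.take B₂).drop A₁) * (maxOcc ((w.take B₃).drop A₂) *
      maxOcc ((w.take B₃).drop A₁)) := by
  obtain ⟨f, hf, hf'⟩ := pair_label w A₁ B₂ S p q hA1 hpq hB2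
    (fun x hx => (hqr x hx).trans (hn x hx)) hw
  obtain ⟨g, hg, hg'⟩ := pair_label w A₂ B₃ S q r hA2 hqr hB3 hn hw'
  obtain ⟨h, hh, hh'⟩ := pair_label w A₁ B₃ S p r hA1
    (fun x hx => (hpq x hx).trans (hqr x hx)) hB3 hn (fun x hx => (hw x hx).trans (hw' x hx))
  have key : S.card ≤ (Finset.range (maxOcc ((w.take B₂).drop A₁)) ×ˢ
      (Finset.range (maxOcc ((w.take B₃).drop A₂)) ×ˢ
        Finset.range (maxOcc ((w.take B₃).drop A₁)))).card := by
    refine Finset.card_le_card_of_injOn (fun x => (f x, g x, h x)) ?_ ?_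
    · intro x hx
      simp [hf x hx, hg x hx, hh x hx]
    · intro x hx y hy hxy
      simp only [Prod.mk.injEq] at hxy
      by_contra hne
      have h1 : p x ≠ p y := fun e => hne (hp hx hy e)
      have h2 : q x ≠ q y := fun e => hne (hq hx hy e)
      have h3 : r x ≠ r y := fun e => hne (hr hx hy e)
      have a1 := hf' x hx y hy
      have a2 := hf' y hy x hx
      have b1 := hg' x hx y hy
      have b2 := hg' y hy x hx
      have c1 := hh' x hx y hy
      have c2 := hh' y hy x hx
      omega
  simpa using key

theorem exists_occ {k : ℕ} (w : List (Fin k)) : ∃ (r : Fin k → ℕ) (P : Fin k → ℕ → ℕ),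
    (∀ a j, j < r a → w[P a j]? = some a) ∧
    (∀ a i j, i < j → j < r a → P a i < P a j) ∧
    ∀ h : ℕ → ℝ, ∑ a, ∑ j ∈ Finset.range (r a), h (P a j) =
      ∑ i ∈ Finset.range w.length, h i := by
  classical
  let S : Fin k → Finset ℕ := fun a => (Finset.range w.length).filter fun i => w[i]? = some a
  refine ⟨fun a => (S a).card, fun a j => if h : j < (S a).card then
    (S a).orderEmbOfFin rfl ⟨j, h⟩ else 0, ?_, ?_, ?_⟩
  · intro a j hj
    have := Finset.orderEmbOfFin_mem (S a) rfl ⟨j, hj⟩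
    simp only [hj, dif_pos]
    exact (Finset.mem_filter.1 this).2
  · intro a i j hij hj
    simp only [hj, hij.trans hj, dif_pos]
    exact ((S a).orderEmbOfFin rfl).strictMono hij
  · intro h
    have h1 : ∀ a, ∑ j ∈ Finset.range (S a).card, h (if h : j < (S a).card then
        (S a).orderEmbOfFin rfl ⟨j, h⟩ else 0) =
        ∑ i ∈ Finset.range w.length, if w[i]? = some a then h i else 0 := by
      intro a
      rw [← Finset.sum_filter, Finset.sum_range]
      simp only [Fin.is_lt, dif_pos, Fin.eta]
      have himg : Finset.univ.image ((S a).orderEmbOfFin rfl) = S a := by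
        simp
      conv_rhs => rw [show (Finset.range w.length).filter (fun i => w[i]? = some a) = S a from rfl,
        ← himg]
      rw [Finset.sum_image (fun x _ y _ hxy => ((S a).orderEmbOfFin rfl).injective hxy)]
    simp only [h1]
    rw [Finset.sum_comm]
    refine Finset.sum_congr rfl fun i hi => ?_
    rw [List.getElem?_eq_getElem (Finset.mem_range.1 hi)]
    simp

theorem sum_shift (g : ℕ → ℝ) (B : ℝ) (r : ℕ) (h0 : ∀ j, 0 ≤ g j) (hB : ∀ j, g j ≤ B) :
    ∑ j ∈ Finset.range (r - 2), (g (j + 2) - g j) ≤ 2 * B := by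
  have : ∀ m, ∑ j ∈ Finset.range m, (g (j + 2) - g j) = g (m + 1) + g m - g 1 - g 0 := by
    intro m
    induction m with
    | zero => simp
    | succ m ih => rw [Finset.sum_range_succ, ih]; ring
  rw [this]
  linarith [hB (r - 2 + 1), hB (r - 2), h0 1, h0 0]

theorem sum_shift_le (h : ℕ → ℝ) (h0 : ∀ j, 0 ≤ h j) (r s : ℕ) (hs : s ≤ 2) :
    ∑ j ∈ Finset.range (r - 2), h (j + s) ≤ ∑ j ∈ Finset.range r, h j := by
  rw [← Finset.sum_image (s := Finset.range (r - 2)) (g := fun j => j + s) (f := h)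
    (fun x _ y _ hxy => by simpa using hxy)]
  refine Finset.sum_le_sum_of_subset_of_nonneg ?_ (fun i _ _ => h0 i)
  intro x hx
  simp only [Finset.mem_image, Finset.mem_range] at hx ⊢
  omega

theorem sum_div (h : ℕ → ℝ) (l T : ℕ) (hl : 0 < l) :
    ∑ i ∈ Finset.range (T * l), h (i / l) = l * ∑ c ∈ Finset.range T, h c := by
  induction T with
  | zero => simp
  | succ T ih =>
    rw [Nat.succ_mul, Finset.sum_range_add, ih, Finset.sum_range_succ, mul_add]
    congr 1
    rw [Finset.sum_congr rfl (g := fun _ => h T)]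
    · simp
    · intro x hx
      congr 1
      rw [Nat.mul_comm, Nat.mul_add_div hl, Nat.div_eq_of_lt (Finset.mem_range.1 hx)]
      simp

theorem log_seg {α : Type*} (w : List α) (A B : ℕ) (hAB : A ≤ B) :
    Real.log (maxOcc ((w.take B).drop A)) ≤
      Real.log (maxOcc (w.take B)) - Real.log (maxOcc (w.take A)) := by
  have h := maxOcc_append ((w.take B).take A) ((w.take B).drop A)
  rw [List.take_append_drop, List.take_take, min_eq_left hAB] at h
  have p1 : (0 : ℝ) < maxOcc (w.take A) := by exact_mod_cast one_le_maxOcc _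
  have p2 : (0 : ℝ) < maxOcc ((w.take B).drop A) := by exact_mod_cast one_le_maxOcc _
  have h' : (maxOcc (w.take A) : ℝ) * maxOcc ((w.take B).drop A) ≤ maxOcc (w.take B) := by
    exact_mod_cast h
  have := Real.log_le_log (mul_pos p1 p2) h'
  rw [Real.log_mul p1.ne' p2.ne'] at this
  linarith

/-- The main inequality. -/
theorem main_ineq {k : ℕ} (w : List (Fin k)) (l T : ℕ) (hl : 0 < l) (hT : w.length ≤ T * l)
    (K : ℝ) (hK : 1 ≤ K) :
    ((w.length : ℝ) - 2 * k - T ^ 3 * K) * Real.log K ≤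
      (4 * k + 3 * l) * Real.log (maxOcc w) := by
  classical
  obtain ⟨r, P, hPw, hPm, hPs⟩ := exists_occ w
  let G : ℕ → ℝ := fun c => Real.log (maxOcc (w.take (c * l)))
  have hlog0 : ∀ u : List (Fin k), 0 ≤ Real.log (maxOcc u) := fun u =>
    Real.log_nonneg (by exact_mod_cast one_le_maxOcc u)
  have hGmono : Monotone G := by
    intro c d hcd
    have := log_seg w (c * l) (d * l) (Nat.mul_le_mul_right l hcd)
    have h2 := hlog0 ((w.take (d * l)).drop (c * l))
    simp only [G]
    linarith
  have hG0 : ∀ c, 0 ≤ G c := fun c => hlog0 _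
  have hGT : ∀ c, G c ≤ Real.log (maxOcc w) := by
    intro c
    have h1 : G (max c T) = Real.log (maxOcc w) := by
      simp only [G]
      rw [List.take_of_length_le (hT.trans (Nat.mul_le_mul_right l (le_max_right c T)))]
    rw [← h1]
    exact hGmono (le_max_left c T)
  have hPn : ∀ a j, j < r a → P a j < w.length := by
    intro a j hj
    have := hPw a j hj
    exact (List.getElem?_eq_some_iff.1 this).1
  have hPinj : ∀ a b i j, i < r a → j < r b → P a i = P b j → a = b ∧ i = j := by
    intro a b i j hi hj h
    have h1 := hPw a i hi
    rw [h, hPw b j hj] at h1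
    have hab : b = a := by simpa using h1
    subst hab
    refine ⟨rfl, ?_⟩
    rcases lt_trichotomy i j with h2 | h2 | h2
    · have := hPm b i j h2 hj; omega
    · exact h2
    · have := hPm b j i h2 hi; omega
  let Ω : Finset (Σ _ : Fin k, ℕ) := Finset.univ.sigma fun a => Finset.range (r a - 2)
  have hΩ : ∀ x ∈ Ω, x.2 + 2 < r x.1 := by
    intro x hx
    simp only [Ω, Finset.mem_sigma, Finset.mem_univ, Finset.mem_range, true_and] at hx
    omega
  let p : ℕ → (Σ _ : Fin k, ℕ) → ℕ := fun s x => P x.1 (x.2 + s)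
  let c : ℕ → (Σ _ : Fin k, ℕ) → ℕ := fun s x => p s x / l
  have hpinj : ∀ s ≤ 2, Set.InjOn (p s) Ω := by
    intro s hs x hx y hy hxy
    have h1 := hΩ x hx
    have h2 := hΩ y hy
    obtain ⟨e1, e2⟩ := hPinj _ _ _ _ (by omega) (by omega) hxy
    rcases x with ⟨a, i⟩
    rcases y with ⟨b, j⟩
    simp only at e1 e2
    have e3 : i = j := by omega
    subst e1 e3
    rfl
  let val : (Σ _ : Fin k, ℕ) → ℝ := fun x =>
    2 * (G (c 2 x + 1) - G (c 0 x)) + (G (c 1 x + 1) - G (c 1 x))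
  let ty : (Σ _ : Fin k, ℕ) → ℕ × ℕ × ℕ := fun x => (c 0 x, c 1 x, c 2 x)
  have hp01 : ∀ x ∈ Ω, p 0 x < p 1 x := fun x hx =>
    hPm _ _ _ (by omega) (by have := hΩ x hx; omega)
  have hp12 : ∀ x ∈ Ω, p 1 x < p 2 x := fun x hx =>
    hPm _ _ _ (by omega) (by have := hΩ x hx; omega)
  have hc01 : ∀ x ∈ Ω, c 0 x ≤ c 1 x := fun x hx => Nat.div_le_div_right (hp01 x hx).le
  have hc12 : ∀ x ∈ Ω, c 1 x ≤ c 2 x := fun x hx => Nat.div_le_div_right (hp12 x hx).le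
  have hval0 : ∀ x ∈ Ω, 0 ≤ val x := by
    intro x hx
    have h1 : G (c 0 x) ≤ G (c 2 x + 1) :=
      hGmono (by have := hc01 x hx; have := hc12 x hx; omega)
    have h2 : G (c 1 x) ≤ G (c 1 x + 1) := hGmono (by omega)
    simp only [val]
    linarith
  have hgood : ∀ x ∈ Ω, K ≤ ((Ω.filter fun y => ty y = ty x).card : ℝ) →
      Real.log K ≤ val x := by
    intro x hx hKx
    have hmem : ∀ y ∈ Ω.filter (fun y => ty y = ty x),
        y ∈ Ω ∧ c 0 y = c 0 x ∧ c 1 y = c 1 x ∧ c 2 y = c 2 x := by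
      intro y hy
      have := Finset.mem_filter.1 hy
      simpa [ty] using this
    have hlo : ∀ s y d, c s y = d → d * l ≤ p s y := by
      intro s y d h
      rw [← h]; exact Nat.div_mul_le_self _ _
    have hhi : ∀ s y d, c s y = d → p s y < (d + 1) * l := by
      intro s y d h
      rw [← h]; exact (Nat.div_lt_iff_lt_mul hl).1 (Nat.lt_succ_self _)
    have hwp : ∀ s ≤ 2, ∀ y ∈ Ω, w[p s y]? = some y.1 := fun s hs y hy =>
      hPw _ _ (by have := hΩ y hy; omega)
    have hcard := triple_card w (c 0 x * l) (c 1 x * l) ((c 1 x + 1) * l) ((c 2 x + 1) * l)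
      (Ω.filter fun y => ty y = ty x) (p 0) (p 1) (p 2)
      (fun y hy => hlo 0 y _ (hmem y hy).2.1) (fun y hy => hlo 1 y _ (hmem y hy).2.2.1)
      (fun y hy => hp01 y (hmem y hy).1) (fun y hy => hp12 y (hmem y hy).1)
      (fun y hy => hhi 1 y _ (hmem y hy).2.2.1) (fun y hy => hhi 2 y _ (hmem y hy).2.2.2)
      (fun y hy => hPn _ _ (hΩ y (hmem y hy).1))
      (fun y hy => (hwp 0 (by omega) y (hmem y hy).1).trans
        (hwp 1 (by omega) y (hmem y hy).1).symm)
      (fun y hy => (hwp 1 (by omega) y (hmem y hy).1).trans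
        (hwp 2 (by omega) y (hmem y hy).1).symm)
      ((hpinj 0 (by omega)).mono (fun y hy => (hmem y hy).1))
      ((hpinj 1 (by omega)).mono (fun y hy => (hmem y hy).1))
      ((hpinj 2 (by omega)).mono (fun y hy => (hmem y hy).1))
    have hcx01 := hc01 x hx
    have hcx12 := hc12 x hx
    have s1 := log_seg w (c 0 x * l) ((c 1 x + 1) * l) (Nat.mul_le_mul_right l (by omega))
    have s2 := log_seg w (c 1 x * l) ((c 2 x + 1) * l) (Nat.mul_le_mul_right l (by omega))
    have s3 := log_seg w (c 0 x * l) ((c 2 x + 1) * l) (Nat.mul_le_mul_right l (by omega))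
    generalize (w.take ((c 1 x + 1) * l)).drop (c 0 x * l) = u1 at hcard s1
    generalize (w.take ((c 2 x + 1) * l)).drop (c 1 x * l) = u2 at hcard s2
    generalize (w.take ((c 2 x + 1) * l)).drop (c 0 x * l) = u3 at hcard s3
    have q1 : (0 : ℝ) < maxOcc u1 := by exact_mod_cast one_le_maxOcc _
    have q2 : (0 : ℝ) < maxOcc u2 := by exact_mod_cast one_le_maxOcc _
    have q3 : (0 : ℝ) < maxOcc u3 := by exact_mod_cast one_le_maxOcc _
    have hle : K ≤ (maxOcc u1 : ℝ) * (maxOcc u2 * maxOcc u3) :=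
      hKx.trans (by exact_mod_cast hcard)
    have hll := Real.log_le_log (by linarith) hle
    rw [Real.log_mul q1.ne' (mul_pos q2 q3).ne', Real.log_mul q2.ne' q3.ne'] at hll
    simp only [val, G]
    linarith
  -- cardinality of Ω
  have hrn : ∑ a, (r a : ℝ) = w.length := by
    have := hPs (fun _ => 1)
    simpa using this
  have hΩcard : (w.length : ℝ) - 2 * k ≤ Ω.card := by
    simp only [Ω, Finset.card_sigma, Finset.card_range, Nat.cast_sum]
    have : ∑ a : Fin k, ((r a : ℝ) - 2) ≤ ∑ a : Fin k, ((r a - 2 : ℕ) : ℝ) := by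
      refine Finset.sum_le_sum fun a _ => ?_
      have : r a ≤ (r a - 2) + 2 := by omega
      have : (r a : ℝ) ≤ ((r a - 2 : ℕ) : ℝ) + 2 := by exact_mod_cast this
      linarith
    rw [Finset.sum_sub_distrib, hrn] at this
    simp only [Finset.sum_const, Finset.card_univ, Fintype.card_fin, nsmul_eq_mul] at this
    linarith
  -- bad triples
  let isBad : (Σ _ : Fin k, ℕ) → Prop := fun x => ((Ω.filter fun y => ty y = ty x).card : ℝ) < K
  have hcT : ∀ s ≤ 2, ∀ x ∈ Ω, c s x < T := by
    intro s hs x hx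
    have h1 : p s x < w.length := hPn _ _ (by have := hΩ x hx; omega)
    exact (Nat.div_lt_iff_lt_mul hl).2 (h1.trans_le hT)
  have hbad : ((Ω.filter isBad).card : ℝ) ≤ T ^ 3 * K := by
    let Ty : Finset (ℕ × ℕ × ℕ) := Finset.range T ×ˢ Finset.range T ×ˢ Finset.range T
    have hmaps : ∀ x ∈ Ω.filter isBad, ty x ∈ Ty := by
      intro x hx
      have hx' := (Finset.mem_filter.1 hx).1
      simp [Ty, ty, hcT _ _ x hx']
    rw [Finset.card_eq_sum_card_fiberwise hmaps, Nat.cast_sum]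
    have : ∀ τ ∈ Ty, (((Ω.filter isBad).filter fun x => ty x = τ).card : ℝ) ≤ K := by
      intro τ _
      rcases Finset.eq_empty_or_nonempty ((Ω.filter isBad).filter fun x => ty x = τ) with h | h
      · rw [h]; simp; linarith
      · obtain ⟨x, hx⟩ := h
        obtain ⟨hx1, hx2⟩ := Finset.mem_filter.1 hx
        have hx3 := (Finset.mem_filter.1 hx1).2
        refine le_trans ?_ (le_of_lt hx3)
        rw [hx2]
        exact_mod_cast Finset.card_le_card
          (Finset.filter_subset_filter _ (Finset.filter_subset _ _))
    refine (Finset.sum_le_sum this).trans ?_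
    simp only [Ty, Finset.sum_const, Finset.card_product, Finset.card_range, nsmul_eq_mul]
    push_cast
    exact le_of_eq (by ring)
  have hlogK : 0 ≤ Real.log K := Real.log_nonneg hK
  have hlower : ((w.length : ℝ) - 2 * k - T ^ 3 * K) * Real.log K ≤ ∑ x ∈ Ω, val x := by
    have hsplit : ((Ω.filter isBad).card : ℝ) + (Ω.filter fun x => ¬ isBad x).card = Ω.card := by
      exact_mod_cast Finset.card_filter_add_card_filter_not (s := Ω) isBad
    have h1 : ((Ω.filter fun x => ¬ isBad x).card : ℝ) * Real.log K ≤
        ∑ x ∈ Ω.filter (fun x => ¬ isBad x), val x := by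
      rw [← nsmul_eq_mul]
      refine Finset.card_nsmul_le_sum _ _ _ fun x hx => ?_
      obtain ⟨h2, h3⟩ := Finset.mem_filter.1 hx
      exact hgood x h2 (not_lt.1 h3)
    have h2 : ∑ x ∈ Ω.filter (fun x => ¬ isBad x), val x ≤ ∑ x ∈ Ω, val x :=
      Finset.sum_le_sum_of_subset_of_nonneg (Finset.filter_subset _ _)
        (fun x hx _ => hval0 x hx)
    refine le_trans ?_ (h1.trans h2)
    exact mul_le_mul_of_nonneg_right (by linarith) hlogK
  refine hlower.trans ?_
  -- upper bound
  let dG : ℕ → ℝ := fun i => G (i / l + 1) - G (i / l)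
  have hdG : ∀ i, 0 ≤ dG i := fun i => sub_nonneg.2 (hGmono (by omega))
  have hdGsum : ∑ i ∈ Finset.range w.length, dG i ≤ l * Real.log (maxOcc w) := by
    have h1 : ∑ i ∈ Finset.range w.length, dG i ≤ ∑ i ∈ Finset.range (T * l), dG i :=
      Finset.sum_le_sum_of_subset_of_nonneg (Finset.range_subset_range.2 hT)
        (fun i _ _ => hdG i)
    have h2 := sum_div (fun c => G (c + 1) - G c) l T hl
    rw [Finset.sum_range_sub] at h2
    refine h1.trans (h2.le.trans ?_)
    refine mul_le_mul_of_nonneg_left ?_ (Nat.cast_nonneg l)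
    linarith [hGT T, hG0 0]
  have hsum : ∑ x ∈ Ω, val x = ∑ a : Fin k, ∑ j ∈ Finset.range (r a - 2),
      (2 * (G (P a (j + 2) / l) - G (P a j / l)) + 2 * dG (P a (j + 2)) + dG (P a (j + 1))) := by
    rw [Finset.sum_sigma]
    refine Finset.sum_congr rfl fun a _ => Finset.sum_congr rfl fun j _ => ?_
    simp only [val, c, p, dG, add_zero]
    ring
  have hper : ∀ a : Fin k, ∑ j ∈ Finset.range (r a - 2),
      (2 * (G (P a (j + 2) / l) - G (P a j / l)) + 2 * dG (P a (j + 2)) + dG (P a (j + 1))) ≤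
      4 * Real.log (maxOcc w) + 3 * ∑ j ∈ Finset.range (r a), dG (P a j) := by
    intro a
    rw [Finset.sum_add_distrib, Finset.sum_add_distrib, ← Finset.mul_sum, ← Finset.mul_sum]
    have h1 := sum_shift (fun j => G (P a j / l)) (Real.log (maxOcc w)) (r a)
      (fun j => hG0 _) (fun j => hGT _)
    have h2 := sum_shift_le (fun j => dG (P a j)) (fun j => hdG _) (r a) 2 le_rfl
    have h3 := sum_shift_le (fun j => dG (P a j)) (fun j => hdG _) (r a) 1 (by omega)
    linarith
  rw [hsum]
  refine (Finset.sum_le_sum fun a _ => hper a).trans ?_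
  rw [Finset.sum_add_distrib, ← Finset.mul_sum, ← Finset.mul_sum, hPs]
  simp only [Finset.sum_const, Finset.card_univ, Fintype.card_fin, nsmul_eq_mul]
  linarith

theorem base_case {k : ℕ} (hk : 2 ≤ k) (w : List (Fin k))
    (h1 : (k : ℝ) * Real.log k ≤ w.length) (h2 : w.length < 2 * ⌈(k : ℝ) * Real.log k⌉₊)
    (hbig : 1 < Real.exp (-30) * k / Real.log k ^ 8) :
    (w.length : ℝ) / (4 * k) * Real.log (Real.exp (-30) * k / Real.log k ^ 8) ≤
      Real.log (maxOcc w) := by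
  have hk0 : (2 : ℝ) ≤ k := by exact_mod_cast hk
  have hkp : (0 : ℝ) < k := by linarith
  set L := Real.log k with hL
  have hLhalf : 1 / 2 ≤ L := by
    have : Real.log 2 ≤ L := Real.log_le_log (by norm_num) hk0
    linarith [Real.log_two_gt_d9]
  have hLpos : 0 < L := by linarith
  have hexp : ∀ m : ℕ, (2 : ℝ) ^ m ≤ Real.exp m := by
    intro m
    have := Real.add_one_le_exp (1 : ℝ)
    calc (2 : ℝ) ^ m ≤ Real.exp 1 ^ m := by gcongr; linarith
      _ = Real.exp m := by rw [← Real.exp_nat_mul, mul_one]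
  have hLbig : 22 ≤ L := by
    rw [one_lt_div (by positivity)] at hbig
    have h3 : (1 / 2 : ℝ) ^ 8 ≤ L ^ 8 := by gcongr
    have h4 := hexp 8
    have h5 : Real.exp (-30) * Real.exp 30 = 1 := by rw [← Real.exp_add]; norm_num
    have h6 : Real.exp 22 * Real.exp ((8 : ℕ) : ℝ) = Real.exp 30 := by
      rw [← Real.exp_add]; norm_num
    have h7 : Real.exp 30 * (1 / 2) ^ 8 ≤ k := by
      have e30 := Real.exp_pos 30
      have : Real.exp 30 * (1 / 2) ^ 8 ≤ Real.exp 30 * (Real.exp (-30) * k) :=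
        mul_le_mul_of_nonneg_left (by linarith) e30.le
      have h8 : Real.exp 30 * (Real.exp (-30) * k) = k := by
        rw [← mul_assoc, mul_comm (Real.exp 30), h5, one_mul]
      linarith
    have h9 : Real.exp 22 ≤ k := by
      refine le_trans ?_ h7
      rw [← h6]
      have := Real.exp_pos 22
      have : Real.exp 22 * 1 ≤ Real.exp 22 * (Real.exp ((8 : ℕ) : ℝ) * (1 / 2) ^ 8) := by
        refine mul_le_mul_of_nonneg_left ?_ this.le
        have : (2 : ℝ) ^ 8 * (1 / 2) ^ 8 ≤ Real.exp ((8 : ℕ) : ℝ) * (1 / 2) ^ 8 :=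
          mul_le_mul_of_nonneg_right h4 (by positivity)
        norm_num at this ⊢
        linarith
      linarith
    have := Real.log_le_log (Real.exp_pos 22) h9
    rwa [Real.log_exp] at this
  have hLk : L ≤ k := by
    have := Real.log_le_sub_one_of_pos hkp
    linarith
  set n : ℝ := (w.length : ℝ) with hn
  set K : ℝ := k / (64 * L ^ 6) with hK
  have hKpos : 0 < K := by positivity
  have hKk : Real.log K ≤ L := by
    refine Real.log_le_log hKpos ?_
    rw [hK, div_le_iff₀ (by positivity)]
    have : (1 : ℝ) ≤ L ^ 6 := one_le_pow₀ (by linarith)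
    nlinarith
  -- comparison of K with the target base
  have hbase : Real.exp (-30) * k / L ^ 8 ≤ Real.exp (-5) * K := by
    have h4 := hexp 25
    have h6 : Real.exp (-30) * Real.exp ((25 : ℕ) : ℝ) = Real.exp (-5) := by
      rw [← Real.exp_add]; norm_num
    have h7 : Real.exp (-30) * 64 ≤ Real.exp (-5) := by
      rw [← h6]
      refine mul_le_mul_of_nonneg_left ?_ (Real.exp_pos _).le
      refine le_trans ?_ h4
      norm_num
    rw [hK, ← mul_div_assoc, div_le_div_iff₀ (by positivity) (by positivity)]
    have h8 : L ^ 6 ≤ L ^ 8 := pow_le_pow_right₀ (by linarith) (by norm_num)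
    calc Real.exp (-30) * k * (64 * L ^ 6) = (Real.exp (-30) * 64) * k * L ^ 6 := by ring
      _ ≤ Real.exp (-5) * k * L ^ 8 := by gcongr
  have hexp5 : Real.exp (-5) ≤ 1 := by rw [Real.exp_le_one_iff]; norm_num
  have hK1 : 1 ≤ K := by
    have : Real.exp (-5) * K ≤ 1 * K := mul_le_mul_of_nonneg_right hexp5 hKpos.le
    linarith
  have hY : Real.log (Real.exp (-30) * k / L ^ 8) ≤ Real.log K - 5 := by
    have := Real.log_le_log (by linarith) hbase
    rw [Real.log_mul (Real.exp_pos _).ne' hKpos.ne', Real.log_exp] at this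
    linarith
  -- parameters
  set l : ℕ := ⌈(k : ℝ) / L⌉₊ with hl
  have hl1 : (k : ℝ) / L ≤ l := Nat.le_ceil _
  have hlpos : 0 < l := Nat.ceil_pos.2 (by positivity)
  have hl2 : (l : ℝ) ≤ 2 * k / L := by
    have h3 : (l : ℝ) < k / L + 1 := Nat.ceil_lt_add_one (by positivity)
    have h4 : 1 ≤ (k : ℝ) / L := by rw [one_le_div hLpos]; exact hLk
    have : 2 * (k : ℝ) / L = k / L + k / L := by ring
    linarith
  set T : ℕ := w.length / l + 1 with hT
  have hTl : w.length ≤ T * l := by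
    exact ((Nat.div_lt_iff_lt_mul hlpos).1 (Nat.lt_succ_self _)).le
  have hn2 : n ≤ 2 * (k * L) + 2 := by
    have h3 : (⌈(k : ℝ) * L⌉₊ : ℝ) < k * L + 1 := Nat.ceil_lt_add_one (by positivity)
    have h4 : n < 2 * (⌈(k : ℝ) * L⌉₊ : ℝ) := by rw [hn]; exact_mod_cast h2
    linarith
  have hT4 : (T : ℝ) ≤ 4 * L ^ 2 := by
    have h3 : ((w.length / l : ℕ) : ℝ) ≤ n / l := Nat.cast_div_le
    have h4 : n / l ≤ n / (k / L) := by
      refine div_le_div_of_nonneg_left (Nat.cast_nonneg _) (by positivity) hl1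
    have h5 : n / (k / L) ≤ 2 * L ^ 2 + 2 := by
      rw [div_le_iff₀ (by positivity)]
      have : (2 * L ^ 2 + 2) * (k / L) = 2 * (k * L) + 2 * (k / L) := by
        field_simp
      rw [this]
      have h4 : 1 ≤ (k : ℝ) / L := by rw [one_le_div hLpos]; exact hLk
      linarith
    have h6 : (T : ℝ) = ((w.length / l : ℕ) : ℝ) + 1 := by rw [hT]; push_cast; rfl
    nlinarith
  have hTK : (T : ℝ) ^ 3 * K ≤ k := by
    calc (T : ℝ) ^ 3 * K ≤ (4 * L ^ 2) ^ 3 * K := by gcongr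
      _ = (k : ℝ) := by rw [hK]; field_simp; norm_num
  have hmain := main_ineq w l T hlpos hTl K hK1
  have hlK0 : 0 ≤ Real.log K := Real.log_nonneg hK1
  set X := Real.log (maxOcc w) with hX
  have hX0 : 0 ≤ X := Real.log_nonneg (by exact_mod_cast one_le_maxOcc w)
  have hnpos : 0 < n := lt_of_lt_of_le (by positivity) h1
  have hm2 : (n - 3 * k) * Real.log K ≤ (4 * k + 6 * k / L) * X := by
    refine le_trans ?_ (hmain.trans ?_)
    · exact mul_le_mul_of_nonneg_right (by linarith) hlK0
    · refine mul_le_mul_of_nonneg_right ?_ hX0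
      have : 6 * (k : ℝ) / L = 3 * (2 * k / L) := by ring
      linarith
  have hden : 0 < 4 * k + 6 * k / L := by positivity
  have hfin : n / (4 * k) * (Real.log K - 5) * (4 * k + 6 * k / L) ≤
      (n - 3 * k) * Real.log K := by
    have e1 : n / (4 * k) * (Real.log K - 5) * (4 * k + 6 * k / L) =
        n * Real.log K + 3 / 2 * n * (Real.log K / L) - 5 * n - 15 / 2 * n / L := by
      field_simp
      ring
    rw [e1]
    have h3 : Real.log K / L ≤ 1 := by rw [div_le_one hLpos]; exact hKk
    have h4 : k * Real.log K ≤ n := (mul_le_mul_of_nonneg_left hKk hkp.le).trans h1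
    have h5 : 0 ≤ 15 / 2 * n / L := by positivity
    have h6 : 3 / 2 * n * (Real.log K / L) ≤ 3 / 2 * n * 1 :=
      mul_le_mul_of_nonneg_left h3 (by positivity)
    nlinarith
  have hq : 0 ≤ n / (4 * k) := by positivity
  have h9 : n / (4 * k) * (Real.log K - 5) ≤ X := by
    refine le_of_mul_le_mul_right ?_ hden
    linarith
  exact (mul_le_mul_of_nonneg_left hY hq).trans h9

theorem all_cases {k : ℕ} (hk : 2 ≤ k)
    (hbig : 1 < Real.exp (-30) * k / Real.log k ^ 8) : ∀ (n : ℕ) (w : List (Fin k)),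
    w.length = n → (k : ℝ) * Real.log k ≤ n →
    (n : ℝ) / (4 * k) * Real.log (Real.exp (-30) * k / Real.log k ^ 8) ≤
      Real.log (maxOcc w) := by
  intro n
  induction n using Nat.strong_induction_on with
  | _ n ih =>
    intro w hw hn
    by_cases h : n < 2 * ⌈(k : ℝ) * Real.log k⌉₊
    · subst hw
      exact base_case hk w hn h hbig
    · set n0 := ⌈(k : ℝ) * Real.log k⌉₊ with hn0
      have hkp : (1 : ℝ) < k := by exact_mod_cast hk
      have hpos : 0 < (k : ℝ) * Real.log k := mul_pos (by linarith) (Real.log_pos hkp)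
      have hn0pos : 0 < n0 := Nat.ceil_pos.2 hpos
      have hle : (k : ℝ) * Real.log k ≤ n0 := Nat.le_ceil _
      have a1 := ih n0 (by omega) (w.take n0) (by simp; omega) hle
      have a2 := ih (n - n0) (by omega) (w.drop n0) (by simp; omega)
        (hle.trans (by exact_mod_cast (by omega : n0 ≤ n - n0)))
      have hm := maxOcc_append (w.take n0) (w.drop n0)
      rw [List.take_append_drop] at hm
      have p1 : (0 : ℝ) < maxOcc (w.take n0) := by exact_mod_cast one_le_maxOcc _
      have p2 : (0 : ℝ) < maxOcc (w.drop n0) := by exact_mod_cast one_le_maxOcc _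
      have hm' : (maxOcc (w.take n0) : ℝ) * maxOcc (w.drop n0) ≤ maxOcc w := by
        exact_mod_cast hm
      have := Real.log_le_log (mul_pos p1 p2) hm'
      rw [Real.log_mul p1.ne' p2.ne'] at this
      have e : (n : ℝ) = n0 + (n - n0 : ℕ) := by
        exact_mod_cast (by omega : n = n0 + (n - n0))
      rw [e, add_div, add_mul]
      linarith

end SubseqOcc

/-- There are absolute constants `c, C > 0` such that for every `k ≥ 2`, every
`n ≥ C·k·log k`, and every word `w` of length `n` over `[k]`,
`M(w) ≥ (c·k/(log k)^8)^{n/(4k)}`. -/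
theorem stmt10 :
    ∃ c C : ℝ, 0 < c ∧ 0 < C ∧ ∀ k n : ℕ, 2 ≤ k → C * k * Real.log k ≤ n →
      ∀ w : List (Fin k), w.length = n →
        (c * k / Real.log k ^ 8) ^ ((n : ℝ) / (4 * k)) ≤ (maxOcc w : ℝ) := by
  refine ⟨Real.exp (-30), 1, Real.exp_pos _, one_pos, ?_⟩
  intro k n hk hn w hw
  have hM : (1 : ℝ) ≤ maxOcc w := by exact_mod_cast SubseqOcc.one_le_maxOcc w
  have hkp : (1 : ℝ) < k := by exact_mod_cast hk
  have hlog := Real.log_pos hkp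
  have hb : 0 < Real.exp (-30) * k / Real.log k ^ 8 := by positivity
  by_cases hbig : 1 < Real.exp (-30) * k / Real.log k ^ 8
  · have := SubseqOcc.all_cases hk hbig n w hw (by linarith)
    rw [Real.rpow_def_of_pos hb, mul_comm, ← Real.le_log_iff_exp_le (by linarith)]
    exact this
  · exact (Real.rpow_le_one hb.le (not_lt.1 hbig) (by positivity)).trans hM
end
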